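/- arXiv:math/0703133 — 2 statements merged into one kernel-verified Lean document; each statement's English description precedes it below -/
import Mathlib

section
/- Let R be a commutative noetherian ring, J ⊆ R an ideal, M a finitely generated R-module, and ⋯ → L_1 → L_0 →^ε M → 0 an exact sequence in which every L_n is a finitely generated R-module. Let (P_{*,m})_{m∈ℕ} be a tower of non-negatively graded chain complexes of R-modules (with R-linear transition chain maps P_{*,m+1} → P_{*,m}) such that each P_{n,m} satisfies J^m•P_{n,m} = 0 and is projective as a module over R/J^m. Let g_m: P_{0,m} → M/J^mM be R-linear maps vanishing on the image of the differential d: P_{1,m} → P_{0,m} and compatible with the transition maps (i.e., the g_m define a strict morphism of towers of chain complexes from P_{*,m} to the complex with M/J^mM concentrated in degree 0). Then there exist a strictly increasing function i: ℕ → ℕ and chain maps φ_m: P_{*,i(m)} → L_*/J^mL_* that are compatible with the transition maps of the two towers and lift g, in the sense that ε̄_m ∘ φ_{m,0} equals the composite of g_{i(m)}: P_{0,i(m)} → M/J^{i(m)}M with the transition map M/J^{i(m)}M → M/J^mM, where ε̄_m: L_0/J^mL_0 → M/J^mM is induced by ε. -/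
variable {R : Type*} [CommRing R]

/-- The composite transition map `P b → P a` (for `a ≤ b`) of a tower of `R`-modules. -/
noncomputable def towerMap {P : ℕ → Type*} [∀ m, AddCommGroup (P m)] [∀ m, Module R (P m)]
    (p : ∀ m, P (m + 1) →ₗ[R] P m) : ∀ {a b : ℕ}, a ≤ b → (P b →ₗ[R] P a) :=
  fun {a _} h =>
    Nat.leRecOn h (fun {k} (g : P k →ₗ[R] P a) => g.comp (p k)) LinearMap.id

/-- The map `M/J^m M → N/J^m N` induced by an `R`-linear map `f : M → N`. -/
noncomputable def mapQPow (J : Ideal R) (m : ℕ)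
    {M N : Type*} [AddCommGroup M] [Module R M] [AddCommGroup N] [Module R N]
    (f : M →ₗ[R] N) :
    (M ⧸ (J ^ m • ⊤ : Submodule R M)) →ₗ[R] N ⧸ (J ^ m • ⊤ : Submodule R N) :=
  Submodule.mapQ _ _ f
    (Submodule.smul_le.2 fun r hr x _ => by
      simp only [Submodule.mem_comap, map_smul]
      exact Submodule.smul_mem_smul hr Submodule.mem_top)

/-- The natural surjection `M/J^{m+1} M → M/J^m M`. -/
noncomputable def transQPow (J : Ideal R) (m : ℕ)
    (M : Type*) [AddCommGroup M] [Module R M] :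
    (M ⧸ (J ^ (m + 1) • ⊤ : Submodule R M)) →ₗ[R] M ⧸ (J ^ m • ⊤ : Submodule R M) :=
  Submodule.mapQ _ _ LinearMap.id
    (by rw [Submodule.comap_id]
        exact Submodule.smul_mono_left (Ideal.pow_le_pow_right (Nat.le_succ m)))

universe u v w

section Recursion

/-- Dependent choice: a partial solution of a recursive system of relations which can be
continued from stage `r` on agrees up to stage `r + 1` with a global solution. -/
theorem exists_extend_solution {β : ℕ → Type*} (E : ∀ k, β k → β (k + 1) → Prop) (r : ℕ)
    (step : ∀ n, r ≤ n → ∀ a b, E n a b → ∃ c, E (n + 1) b c)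
    (f : ∀ k, β k) (hf : ∀ k < r + 1, E k (f k) (f (k + 1))) :
    ∃ f' : ∀ k, β k, (∀ k ≤ r + 1, f' k = f k) ∧ ∀ k, E k (f' k) (f' (k + 1)) := by
  have key : ∀ (n : ℕ) (F : {F : ∀ k, β k // ∀ k < r + 1 + n, E k (F k) (F (k + 1))}),
      ∃ F' : {F : ∀ k, β k // ∀ k < r + 1 + (n + 1), E k (F k) (F (k + 1))},
        ∀ k ≤ r + 1 + n, F'.1 k = F.1 k := by
    rintro n ⟨F, hF⟩
    obtain ⟨c, hc⟩ := step (r + n) (by omega) (F (r + n)) (F (r + n + 1)) (hF _ (by omega))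
    refine ⟨⟨Function.update F (r + n + 1 + 1) c, fun k hk => ?_⟩, fun k hk => ?_⟩
    · rcases (show k < r + 1 + n ∨ k = r + n + 1 by omega) with h | rfl
      · rw [Function.update_of_ne (by omega), Function.update_of_ne (by omega)]
        exact hF k h
      · rw [Function.update_of_ne (by omega), Function.update_self]
        exact hc
    · exact Function.update_of_ne (by omega) _ _
  choose next hnext using key
  let F : ∀ n, {F : ∀ k, β k // ∀ k < r + 1 + n, E k (F k) (F (k + 1))} :=
    fun n => Nat.rec ⟨f, hf⟩ (fun n F => next n F) n
  have hF : ∀ n, ∀ k ≤ r + 1 + n, (F (n + 1)).1 k = (F n).1 k := fun n => hnext n (F n)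
  have hF0 : ∀ n, ∀ k ≤ r + 1, (F n).1 k = f k := by
    intro n
    induction n with
    | zero => exact fun k _ => rfl
    | succ n ih => exact fun k hk => (hF n k (by omega)).trans (ih k hk)
  refine ⟨fun k => (F k).1 k, fun k hk => hF0 k k hk, fun k => ?_⟩
  have := (F (k + 1)).2 k (by omega)
  rwa [hF k k (by omega)] at this

/-- The level at which one must start in order to perform `N` recursive steps and end at
level `m`, when the step `k` ending at level `m` must start at level `s k m`. -/
def startLevel (s : ℕ → ℕ → ℕ) : ℕ → ℕ → ℕ
  | 0, m => m
  | N + 1, m => startLevel s N (s N m)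

theorem le_startLevel {s : ℕ → ℕ → ℕ} (hs : ∀ N m, m ≤ s N m) :
    ∀ N m, m ≤ startLevel s N m
  | 0, _ => le_rfl
  | N + 1, m => (hs N m).trans (le_startLevel hs N _)

/-- Recursive construction of the first `N` terms of a solution in a tower of recursive
systems, where each step lowers the level in the tower. -/
theorem exists_partial_solution {α : ℕ → ℕ → Type*} [∀ m k, Nonempty (α m k)]
    (tr : ∀ {m m' : ℕ}, m ≤ m' → ∀ k, α m' k → α m k) (i : ℕ)
    (E : ∀ m, m ≤ i → ∀ k, α m k → α m (k + 1) → Prop)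
    (G : ∀ m, m ≤ i → ∀ k, α m k → Prop) (K : ∀ m, m ≤ i → α m 0 → Prop)
    (s : ℕ → ℕ → ℕ) (hs : ∀ N m, m ≤ s N m)
    (hE : ∀ m m' (h : m ≤ m') (h' : m' ≤ i) k a b, E m' h' k a b →
      E m (h.trans h') k (tr h k a) (tr h (k + 1) b))
    (hK : ∀ m m' (h : m ≤ m') (h' : m' ≤ i) a, K m' h' a → K m (h.trans h') (tr h 0 a))
    (base : ∀ m (h : m ≤ i), ∃ a, G m h 0 a ∧ K m h a)
    (step : ∀ N m (h : s N m ≤ i) a, G (s N m) h N a →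
      ∃ c, E m ((hs N m).trans h) N (tr (hs N m) N a) c ∧ G m ((hs N m).trans h) (N + 1) c) :
    ∀ N m (h : startLevel s N m ≤ i), ∃ f : ∀ k, α m k,
      (∀ k < N, E m ((le_startLevel hs N m).trans h) k (f k) (f (k + 1))) ∧
      G m ((le_startLevel hs N m).trans h) N (f N) ∧
      K m ((le_startLevel hs N m).trans h) (f 0) := by
  intro N
  induction N with
  | zero =>
    intro m h
    obtain ⟨a, ha, hKa⟩ := base m h
    refine ⟨Function.update (fun k => Classical.arbitrary _) 0 a, fun k hk => by omega, ?_, ?_⟩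
    · rwa [Function.update_self]
    · rwa [Function.update_self]
  | succ N ih =>
    intro m h
    have hl := le_startLevel hs N (s N m)
    obtain ⟨f, hf, hG, hKf⟩ := ih (s N m) h
    obtain ⟨c, hc, hGc⟩ := step N m (hl.trans h) (f N) hG
    refine ⟨Function.update (fun k => tr (hs N m) k (f k)) (N + 1) c, fun k hk => ?_, ?_, ?_⟩
    · rcases (show k < N ∨ k = N by omega) with hkN | rfl
      · rw [Function.update_of_ne (by omega), Function.update_of_ne (by omega)]
        exact hE _ _ _ _ _ _ _ (hf k hkN)
      · rw [Function.update_of_ne (by omega), Function.update_self]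
        exact hc
    · rwa [Function.update_self]
    · rw [Function.update_of_ne (by omega)]
      exact hK _ _ _ _ _ hKf

end Recursion

section Modules

variable {R : Type u} [CommRing R]

theorem map_mem_ideal_smul_top {M N : Type*} [AddCommGroup M] [Module R M] [AddCommGroup N]
    [Module R N] (f : M →ₗ[R] N) {I : Ideal R} {x : M} (hx : x ∈ (I • ⊤ : Submodule R M)) :
    f x ∈ (I • ⊤ : Submodule R N) := by
  have : f x ∈ (I • ⊤ : Submodule R M).map f := Submodule.mem_map_of_mem hx
  rw [Submodule.map_smul''] at this
  exact Submodule.smul_mono le_rfl le_top this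

/-- A module which is killed by `I` and projective over `R ⧸ I` has the lifting property with
respect to modules which are killed by `I`. -/
theorem exists_lift_of_isTorsionBySet (I : Ideal R) {P A B : Type*}
    [AddCommGroup P] [Module R P] [AddCommGroup A] [Module R A] [AddCommGroup B] [Module R B]
    (hP : Module.IsTorsionBySet R P (I : Set R))
    (hproj : letI := hP.module; Module.Projective (R ⧸ I) P)
    (hA : ∀ r ∈ I, ∀ a : A, r • a = 0) (f : A →ₗ[R] B) (h : P →ₗ[R] B)
    (hfh : ∀ x, h x ∈ LinearMap.range f) : ∃ l : P →ₗ[R] A, f.comp l = h := by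
  let := hP.module
  have hA' : Module.IsTorsionBySet R A (I : Set R) := fun a r => hA r r.2 a
  have hB' : Module.IsTorsionBySet R (LinearMap.range f) (I : Set R) := by
    rintro ⟨_, a, rfl⟩ r
    ext
    simp [← map_smul, hA r r.2 a]
  let := hA'.module
  let := hB'.module
  let f' : A →ₗ[R ⧸ I] LinearMap.range f :=
    { toFun := f.rangeRestrict
      map_add' := map_add _
      map_smul' := by
        intro r a
        obtain ⟨r, rfl⟩ := Ideal.Quotient.mk_surjective r
        exact map_smul f.rangeRestrict r a }
  let h' : P →ₗ[R ⧸ I] LinearMap.range f :=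
    { toFun := h.codRestrict _ hfh
      map_add' := map_add _
      map_smul' := by
        intro r a
        obtain ⟨r, rfl⟩ := Ideal.Quotient.mk_surjective r
        exact map_smul (h.codRestrict _ hfh) r a }
  obtain ⟨l, hl⟩ := Module.projective_lifting_property f' h' f.surjective_rangeRestrict
  refine ⟨{ toFun := l, map_add' := map_add l, map_smul' := fun r x => ?_ }, ?_⟩
  · exact map_smul l (Ideal.Quotient.mk I r) x
  · ext x
    exact congrArg Subtype.val (LinearMap.congr_fun hl x)

variable (J : Ideal R) {M N K : Type*} [AddCommGroup M] [Module R M] [AddCommGroup N]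
  [Module R N] [AddCommGroup K] [Module R K]

theorem transQPow_eq_factorPow (m : ℕ) :
    transQPow J m M = Submodule.factorPow J M (Nat.le_succ m) := rfl

@[simp]
theorem mapQPow_mk (m : ℕ) (f : M →ₗ[R] N) (x : M) :
    mapQPow J m f (Submodule.Quotient.mk x) = Submodule.Quotient.mk (f x) := rfl

theorem factorPow_mk {m m' : ℕ} (h : m ≤ m') (x : M) :
    Submodule.factorPow J M h (Submodule.Quotient.mk x) = Submodule.Quotient.mk x := rfl

theorem factorPow_factorPow {a b c : ℕ} (h : a ≤ b) (h' : b ≤ c)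
    (x : M ⧸ (J ^ c • ⊤ : Submodule R M)) :
    Submodule.factorPow J M h (Submodule.factorPow J M h' x)
      = Submodule.factorPow J M (h.trans h') x := by
  obtain ⟨x, rfl⟩ := Submodule.Quotient.mk_surjective _ x
  rfl

theorem factorPow_surjective {a b : ℕ} (h : a ≤ b) :
    Function.Surjective (Submodule.factorPow J M h) := fun x => by
  obtain ⟨x, rfl⟩ := Submodule.Quotient.mk_surjective _ x
  exact ⟨Submodule.Quotient.mk x, rfl⟩

theorem mapQPow_factorPow {m m' : ℕ} (h : m ≤ m') (f : M →ₗ[R] N)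
    (x : M ⧸ (J ^ m' • ⊤ : Submodule R M)) :
    mapQPow J m f (Submodule.factorPow J M h x)
      = Submodule.factorPow J N h (mapQPow J m' f x) := by
  obtain ⟨x, rfl⟩ := Submodule.Quotient.mk_surjective _ x
  rfl

theorem mapQPow_mapQPow (m : ℕ) (f : M →ₗ[R] N) (g : N →ₗ[R] K)
    (x : M ⧸ (J ^ m • ⊤ : Submodule R M)) :
    mapQPow J m g (mapQPow J m f x) = mapQPow J m (g.comp f) x := by
  obtain ⟨x, rfl⟩ := Submodule.Quotient.mk_surjective _ x
  rfl

theorem smul_quotient_eq_zero {m i : ℕ} (h : m ≤ i) {r : R}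
    (hr : r ∈ J ^ i) (x : M ⧸ (J ^ m • ⊤ : Submodule R M)) : r • x = 0 := by
  obtain ⟨x, rfl⟩ := Submodule.Quotient.mk_surjective _ x
  rw [← Submodule.Quotient.mk_smul, Submodule.Quotient.mk_eq_zero]
  exact Submodule.smul_mem_smul (Ideal.pow_le_pow_right h hr) Submodule.mem_top

/-- Right exactness of `M ↦ M / J ^ m M`. -/
theorem mem_range_mapQPow_of_surjective (m : ℕ) (f : M →ₗ[R] N) (g : N →ₗ[R] K)
    (hg : Function.Surjective g) (hfg : LinearMap.ker g ≤ LinearMap.range f)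
    (z : N ⧸ (J ^ m • ⊤ : Submodule R N)) (hz : mapQPow J m g z = 0) :
    z ∈ LinearMap.range (mapQPow J m f) := by
  obtain ⟨z, rfl⟩ := Submodule.Quotient.mk_surjective _ z
  rw [mapQPow_mk, Submodule.Quotient.mk_eq_zero, ← LinearMap.range_eq_top.2 hg,
    ← Submodule.map_top, ← Submodule.map_smul''] at hz
  obtain ⟨y, hy, hyz⟩ := hz
  obtain ⟨x, hx⟩ := hfg (show z - y ∈ LinearMap.ker g by simp [hyz])
  refine ⟨Submodule.Quotient.mk x, ?_⟩
  rw [mapQPow_mk, hx, Submodule.Quotient.eq]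
  simpa using hy

/-- A form of the Artin–Rees lemma: cycles modulo a high power of `J` are boundaries modulo a
given power of `J`. -/
theorem exists_factorPow_mem_range [IsNoetherianRing R] [Module.Finite R K]
    (f : M →ₗ[R] N) (g : N →ₗ[R] K) (hfg : LinearMap.ker g ≤ LinearMap.range f) (m : ℕ) :
    ∃ (m' : ℕ) (h : m ≤ m'), ∀ z : N ⧸ (J ^ m' • ⊤ : Submodule R N), mapQPow J m' g z = 0 →
      Submodule.factorPow J N h z ∈ LinearMap.range (mapQPow J m f) := by
  obtain ⟨c, hc⟩ := J.exists_pow_inf_eq_pow_smul (LinearMap.range g)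
  refine ⟨m + c, Nat.le_add_right _ _, fun z hz => ?_⟩
  obtain ⟨z, rfl⟩ := Submodule.Quotient.mk_surjective _ z
  rw [mapQPow_mk, Submodule.Quotient.mk_eq_zero] at hz
  have h1 : g z ∈ J ^ (m + c) • ⊤ ⊓ LinearMap.range g := ⟨hz, z, rfl⟩
  rw [hc _ (Nat.le_add_left _ _), Nat.add_sub_cancel] at h1
  have h2 : g z ∈ J ^ m • LinearMap.range g := Submodule.smul_mono le_rfl inf_le_right h1
  rw [← Submodule.map_top, ← Submodule.map_smul''] at h2
  obtain ⟨y, hy, hyz⟩ := h2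
  obtain ⟨x, hx⟩ := hfg (show z - y ∈ LinearMap.ker g by simp [hyz])
  refine ⟨Submodule.Quotient.mk x, ?_⟩
  rw [mapQPow_mk, hx, factorPow_mk, Submodule.Quotient.eq]
  simpa using hy

end Modules

section Towers

variable {R : Type u} [CommRing R]

theorem towerMap_refl {P : ℕ → Type*} [∀ m, AddCommGroup (P m)] [∀ m, Module R (P m)]
    (p : ∀ m, P (m + 1) →ₗ[R] P m) (a : ℕ) (h : a ≤ a) : towerMap p h = LinearMap.id :=
  Nat.leRecOn_self _

theorem towerMap_succ {P : ℕ → Type*} [∀ m, AddCommGroup (P m)] [∀ m, Module R (P m)]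
    (p : ∀ m, P (m + 1) →ₗ[R] P m) {a b : ℕ} (h : a ≤ b) (h' : a ≤ b + 1) :
    towerMap p h' = (towerMap p h).comp (p b) :=
  Nat.leRecOn_succ h _

theorem towerMap_natural {P Q : ℕ → Type*} [∀ m, AddCommGroup (P m)] [∀ m, Module R (P m)]
    [∀ m, AddCommGroup (Q m)] [∀ m, Module R (Q m)]
    (p : ∀ m, P (m + 1) →ₗ[R] P m) (q : ∀ m, Q (m + 1) →ₗ[R] Q m) (f : ∀ m, P m →ₗ[R] Q m)
    (hf : ∀ m, (q m).comp (f (m + 1)) = (f m).comp (p m)) {a b : ℕ} (h : a ≤ b) :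
    (towerMap q h).comp (f b) = (f a).comp (towerMap p h) := by
  induction b, h using Nat.le_induction with
  | base => simp [towerMap_refl]
  | succ b h ih =>
    rw [towerMap_succ q h, towerMap_succ p h, LinearMap.comp_assoc, hf, ← LinearMap.comp_assoc,
      ih, LinearMap.comp_assoc]

theorem towerMap_transQPow (J : Ideal R) {M : Type*} [AddCommGroup M] [Module R M] {a b : ℕ}
    (h : a ≤ b) :
    towerMap (P := fun m => M ⧸ (J ^ m • ⊤ : Submodule R M)) (fun m => transQPow J m M) h
      = Submodule.factorPow J M h := by
  induction b, h using Nat.le_induction with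
  | base =>
    rw [towerMap_refl]
    ext x
    rfl
  | succ b h ih =>
    rw [towerMap_succ _ h, ih]
    ext x
    rfl

end Towers

section Cone

variable {R : Type u} [CommRing R]

/-- A uniform version, for a family of modules, of the stabilization of the ascending chain of
submodules `{a | z ^ b • a ∈ I X}`. -/
def UniformlyStable (X : ℕ → Type v) [∀ n, AddCommGroup (X n)] [∀ n, Module R (X n)] : Prop :=
  ∀ (I : Ideal R) (z : R), ∃ b : ℕ, ∀ (n m : ℕ) (a : X n),
    z ^ (b + m) • a ∈ (I • ⊤ : Submodule R (X n)) → z ^ b • a ∈ (I • ⊤ : Submodule R (X n))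

theorem uniformlyStable_pi [IsNoetherianRing R] (k : ℕ → ℕ) :
    UniformlyStable (R := R) (fun n => Fin (k n) → R) := by
  have hmem : ∀ (I : Ideal R) (n : ℕ) (a : Fin n → R),
      a ∈ (I • ⊤ : Submodule R (Fin n → R)) ↔ ∀ j, a j ∈ I := by
    intro I n a
    refine ⟨fun ha j => ?_, fun ha => ?_⟩
    · simpa using map_mem_ideal_smul_top (LinearMap.proj (R := R) (φ := fun _ : Fin n => R) j) ha
    · rw [pi_eq_sum_univ a]
      exact Submodule.sum_mem _ fun j _ => Submodule.smul_mem_smul (ha j) Submodule.mem_top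
  intro I z
  obtain ⟨b, hb⟩ := monotone_stabilizes_iff_noetherian.2 (inferInstance : IsNoetherian R R)
    ⟨fun b => Submodule.comap (LinearMap.lsmul R R (z ^ b)) I, by
      refine monotone_nat_of_le_succ fun b x hx => ?_
      simp only [Submodule.mem_comap, LinearMap.lsmul_apply, smul_eq_mul, pow_succ'] at hx ⊢
      rw [mul_assoc]
      exact I.mul_mem_left _ hx⟩
  refine ⟨b, fun n m a ha => ?_⟩
  rw [hmem] at ha ⊢
  intro j
  have := (hb (b + m) (Nat.le_add_right _ _)).ge (x := a j) (by simpa using ha j)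
  simpa using this

theorem mem_span_singleton_smul_top {M : Type*} [AddCommGroup M] [Module R M] {y : R} {x : M} :
    x ∈ (Ideal.span {y} • ⊤ : Submodule R M) ↔ ∃ w, y • w = x := by
  simp [Submodule.ideal_span_singleton_smul, Submodule.mem_smul_pointwise_iff_exists]

/-- The shifted differential `X n → X (n - 1)`, by convention zero for `n = 0`. -/
def predDiff {X : ℕ → Type v} [∀ n, AddCommGroup (X n)] [∀ n, Module R (X n)]
    (d : ∀ n, X (n + 1) →ₗ[R] X n) : ∀ n, X n →ₗ[R] X (n - 1)
  | 0 => 0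
  | n + 1 => d n

variable {X : ℕ → Type v} [∀ n, AddCommGroup (X n)] [∀ n, Module R (X n)]

theorem predDiff_comp (d : ∀ n, X (n + 1) →ₗ[R] X n) (hd : ∀ n x, d n (d (n + 1) x) = 0)
    (n : ℕ) (x : X (n + 1)) : predDiff d n (d n x) = 0 := by
  cases n with
  | zero => rfl
  | succ n => exact hd n x

/-- The map induced by `f` modulo `y`. -/
def quotSpanMap (y : R) {M N : Type*} [AddCommGroup M] [Module R M] [AddCommGroup N]
    [Module R N] (f : M →ₗ[R] N) :
    (M ⧸ (Ideal.span {y} • ⊤ : Submodule R M)) →ₗ[R] N ⧸ (Ideal.span {y} • ⊤ : Submodule R N) :=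
  Submodule.mapQ _ _ f fun _ hx => map_mem_ideal_smul_top f hx

/-- The degree `n` part of the cone of `y ^ m : X / y ^ c → X / y ^ (c + m)`. -/
abbrev TruncCone (X : ℕ → Type v) [∀ n, AddCommGroup (X n)] [∀ n, Module R (X n)]
    (y : R) (c m n : ℕ) : Type v :=
  (X n ⧸ (Ideal.span {y ^ (c + m)} • ⊤ : Submodule R (X n))) ×
    (X (n - 1) ⧸ (Ideal.span {y ^ c} • ⊤ : Submodule R (X (n - 1))))

/-- Multiplication by `y ^ m` as a map `M / y ^ c → M / y ^ (c + m)`. -/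
def mulPowQuot (y : R) (c m : ℕ) (M : Type*) [AddCommGroup M] [Module R M] :
    (M ⧸ (Ideal.span {y ^ c} • ⊤ : Submodule R M)) →ₗ[R]
      M ⧸ (Ideal.span {y ^ (c + m)} • ⊤ : Submodule R M) :=
  Submodule.mapQ _ _ (LinearMap.lsmul R M (y ^ m)) fun x hx => by
    obtain ⟨w, rfl⟩ := mem_span_singleton_smul_top.1 hx
    exact mem_span_singleton_smul_top.2 ⟨w, by simp [smul_smul, pow_add]⟩

/-- The differential of the cone of `y ^ m : X / y ^ c → X / y ^ (c + m)`. -/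
def truncConeDiff (d : ∀ n, X (n + 1) →ₗ[R] X n) (y : R) (c m n : ℕ) :
    TruncCone X y c m (n + 1) →ₗ[R] TruncCone X y c m n :=
  LinearMap.prod
    ((quotSpanMap _ (d n)).comp (LinearMap.fst R _ _) +
      (mulPowQuot y c m (X n)).comp (LinearMap.snd R _ _))
    (-(quotSpanMap _ (predDiff d n)).comp (LinearMap.snd R _ _))

theorem truncConeDiff_mk (d : ∀ n, X (n + 1) →ₗ[R] X n) (y : R) (c m n : ℕ)
    (a : X (n + 1)) (b : X n) :
    truncConeDiff d y c m n (Submodule.Quotient.mk a, Submodule.Quotient.mk b)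
      = (Submodule.Quotient.mk (d n a + y ^ m • b),
        Submodule.Quotient.mk (-(predDiff d n b))) := rfl

theorem truncCone_ind {y : R} {c m n : ℕ} {p : TruncCone X y c m (n + 1) → Prop}
    (h : ∀ (a : X (n + 1)) (b : X n), p (Submodule.Quotient.mk a, Submodule.Quotient.mk b))
    (x) : p x := by
  obtain ⟨a, b⟩ := x
  obtain ⟨a, rfl⟩ := Submodule.Quotient.mk_surjective _ a
  obtain ⟨b, rfl⟩ := Submodule.Quotient.mk_surjective _ b
  exact h a b

theorem truncConeDiff_truncConeDiff (d : ∀ n, X (n + 1) →ₗ[R] X n)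
    (hd : ∀ n x, d n (d (n + 1) x) = 0) (y : R) (c m n : ℕ) (x : TruncCone X y c m (n + 2)) :
    truncConeDiff d y c m n (truncConeDiff d y c m (n + 1) x) = 0 := by
  induction x using truncCone_ind with
  | h a b =>
  have h2 : predDiff d (n + 1) b = d n b := rfl
  rw [truncConeDiff_mk, h2, truncConeDiff_mk, map_neg, predDiff_comp d hd]
  simp [hd]

theorem truncCone_exact (d : ∀ n, X (n + 1) →ₗ[R] X n)
    (hd : ∀ n x, d n (d (n + 1) x) = 0) (r : ℕ)
    (hex : ∀ n, r ≤ n → ∀ x, d n x = 0 → ∃ w, d (n + 1) w = x) (y : R) (c m : ℕ)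
    (hc : ∀ (n : ℕ) (a : X n), y ^ (c + m) • a = 0 → y ^ c • a = 0)
    (n : ℕ) (hn : r + 1 ≤ n) (x : TruncCone X y c m (n + 1))
    (hx : truncConeDiff d y c m n x = 0) :
    ∃ w, truncConeDiff d y c m (n + 1) w = x := by
  obtain ⟨n, rfl⟩ : ∃ k, n = k + 1 := ⟨n - 1, by omega⟩
  induction x using truncCone_ind with
  | h a b =>
  rw [truncConeDiff_mk, Prod.mk_eq_zero, Submodule.Quotient.mk_eq_zero,
    Submodule.Quotient.mk_eq_zero, mem_span_singleton_smul_top, mem_span_singleton_smul_top] at hx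
  obtain ⟨⟨s, hs⟩, hx₂⟩ := hx
  obtain ⟨w, hw⟩ : ∃ w : X n, y ^ c • w = -(d n b) := hx₂
  have hab : d (n + 1) a + y ^ m • (b - y ^ c • s) = 0 := by
    rw [smul_sub, smul_smul, ← pow_add, add_comm m c, hs]
    abel
  have hb : d n (b - y ^ c • s) = 0 := by
    have h1 : y ^ m • d n (b - y ^ c • s) = 0 := by
      have := congrArg (d n) hab
      simpa [hd] using this
    have h2 : d n (b - y ^ c • s) = y ^ c • (-(w + d n s)) := by
      rw [map_sub, map_smul, smul_neg, smul_add, hw]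
      abel
    rw [h2] at h1 ⊢
    rw [smul_smul, ← pow_add, add_comm m c] at h1
    exact hc _ _ h1
  obtain ⟨b', hb'⟩ := hex n (by omega) _ hb
  obtain ⟨a', ha'⟩ := hex (n + 1) (by omega) (a + y ^ m • b') (by
    rw [map_add, map_smul, hb', hab])
  refine ⟨(Submodule.Quotient.mk a', Submodule.Quotient.mk (-b')), ?_⟩
  have h2 : predDiff d (n + 1 + 1) (-b') = d (n + 1) (-b') := rfl
  rw [truncConeDiff_mk, h2, ha']
  refine Prod.ext ?_ ?_
  · simp
  · rw [map_neg, neg_neg, hb', Submodule.Quotient.eq]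
    exact mem_span_singleton_smul_top.2 ⟨-s, by simp⟩

theorem UniformlyStable.truncCone (hX : UniformlyStable (R := R) X) (y : R) (c m : ℕ) :
    UniformlyStable (R := R) (TruncCone X y c m) := by
  have hq : ∀ (t : R) (I : Ideal R) (z : R), ∃ b : ℕ, ∀ (n m : ℕ)
      (a : X n ⧸ (Ideal.span {t} • ⊤ : Submodule R (X n))), z ^ (b + m) • a ∈ I • (⊤ : Submodule R
        (X n ⧸ (Ideal.span {t} • ⊤ : Submodule R (X n)))) → z ^ b • a ∈ I • (⊤ : Submodule R
        (X n ⧸ (Ideal.span {t} • ⊤ : Submodule R (X n)))) := by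
    intro t I z
    have hmem : ∀ (n : ℕ) (x : X n), (Submodule.Quotient.mk x ∈ I • (⊤ : Submodule R
        (X n ⧸ (Ideal.span {t} • ⊤ : Submodule R (X n)))) ↔
          x ∈ ((I ⊔ Ideal.span {t}) • ⊤ : Submodule R (X n))) := by
      intro n x
      rw [Submodule.sup_smul, ← Submodule.mkQ_apply, ← Submodule.mem_comap,
        ← LinearMap.range_eq_top.2 (Submodule.mkQ_surjective _), ← Submodule.map_top,
        ← Submodule.map_smul'', Submodule.comap_map_eq, Submodule.ker_mkQ]
    obtain ⟨b, hb⟩ := hX (I ⊔ Ideal.span {t}) z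
    refine ⟨b, fun n m a ha => ?_⟩
    obtain ⟨a, rfl⟩ := Submodule.Quotient.mk_surjective _ a
    rw [← Submodule.Quotient.mk_smul, hmem] at ha ⊢
    exact hb n m a ha
  intro I z
  obtain ⟨b₁, h₁⟩ := hq (y ^ (c + m)) I z
  obtain ⟨b₂, h₂⟩ := hq (y ^ c) I z
  refine ⟨b₁ + b₂, fun n k x hx => ?_⟩
  have hx₁ := h₁ n (b₂ + k) x.1 (by
    rw [← add_assoc]
    exact map_mem_ideal_smul_top (LinearMap.fst R _ _) hx)
  have hx₂ := h₂ (n - 1) (b₁ + k) x.2 (by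
    rw [← add_assoc, add_comm b₂ b₁]
    exact map_mem_ideal_smul_top (LinearMap.snd R _ _) hx)
  have hsum : z ^ (b₁ + b₂) • x = z ^ b₂ • LinearMap.inl R _ _ (z ^ b₁ • x.1)
      + z ^ b₁ • LinearMap.inr R _ _ (z ^ b₂ • x.2) := by
    refine Prod.ext ?_ ?_
    · simp [smul_smul, pow_add, mul_comm]
    · simp [smul_smul, pow_add]
  rw [hsum]
  exact add_mem (Submodule.smul_mem _ _ (map_mem_ideal_smul_top _ hx₁))
    (Submodule.smul_mem _ _ (map_mem_ideal_smul_top _ hx₂))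

/-- A chain map from a uniformly stable complex, exact in high degrees, to a complex which is
killed by `y ^ m` for all `y` in a list factors through a complex which is exact in high degrees
and is killed by an ideal whose radical contains the list. -/
theorem exists_factorization_of_list (m : ℕ) {W : ℕ → Type w} [∀ n, AddCommGroup (W n)]
    [∀ n, Module R (W n)] (dW : ∀ n, W (n + 1) →ₗ[R] W n) (l : List R)
    (hW : ∀ y ∈ l, ∀ n (x : W n), y ^ m • x = 0) :
    ∀ (X : ℕ → Type v) [∀ n, AddCommGroup (X n)] [∀ n, Module R (X n)]
      (d : ∀ n, X (n + 1) →ₗ[R] X n) (_ : ∀ n x, d n (d (n + 1) x) = 0)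
      (_ : UniformlyStable (R := R) X) (r : ℕ)
      (_ : ∀ n, r ≤ n → ∀ x, d n x = 0 → ∃ w, d (n + 1) w = x)
      (f : ∀ n, X n →ₗ[R] W n) (_ : ∀ n x, dW n (f (n + 1) x) = f n (d n x)),
      ∃ (Y : ℕ → Type v) (_ : ∀ n, AddCommGroup (Y n)) (_ : ∀ n, Module R (Y n))
        (dY : ∀ n, Y (n + 1) →ₗ[R] Y n) (r' : ℕ) (A : Ideal R)
        (u : ∀ n, X n →ₗ[R] Y n) (v : ∀ n, Y n →ₗ[R] W n),
        (∀ n, r' ≤ n → ∀ x, dY n x = 0 → ∃ w, dY (n + 1) w = x) ∧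
        (∀ n x, dY n (u (n + 1) x) = u n (d n x)) ∧
        (∀ n x, dW n (v (n + 1) x) = v n (dY n x)) ∧
        (∀ n x, v n (u n x) = f n x) ∧
        (∀ s ∈ A, ∀ n (x : Y n), s • x = 0) ∧
        (∀ s : R, (∀ n (x : X n), s • x = 0) → s ∈ A) ∧ (∀ y ∈ l, y ∈ A.radical) := by
  induction l with
  | nil =>
    intro X _ _ d _ _ r hex f hf
    exact ⟨X, inferInstance, inferInstance, d, r, ⨅ n, Module.annihilator R (X n),
      fun n => LinearMap.id, f, hex, fun _ _ => rfl, hf, fun _ _ => rfl,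
      fun s hs n x => Module.mem_annihilator.1 (Ideal.mem_iInf.1 hs n) x,
      fun s hs => Ideal.mem_iInf.2 fun n => Module.mem_annihilator.2 (hs n), by simp⟩
  | cons y l ih =>
    intro X _ _ d hd hX r hex f hf
    obtain ⟨c, hc⟩ := hX ⊥ y
    have hker : ∀ n, (Ideal.span {y ^ (c + m)} • ⊤ : Submodule R (X n)) ≤ LinearMap.ker (f n) := by
      intro n x hx
      obtain ⟨w, rfl⟩ := mem_span_singleton_smul_top.1 hx
      rw [LinearMap.mem_ker, map_smul, pow_add, mul_smul, hW y List.mem_cons_self, smul_zero]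
    obtain ⟨Y, iY₁, iY₂, dY, r', A, u, v, hYex, hu, hv, huv, hA, hA', hl⟩ :=
      ih (fun z hz => hW z (List.mem_cons_of_mem _ hz)) (TruncCone X y c m)
        (truncConeDiff d y c m) (truncConeDiff_truncConeDiff d hd y c m) (hX.truncCone y c m) (r + 1)
        (truncCone_exact d hd r hex y c m fun n a ha => by
          have := hc n m a
          simp only [Submodule.bot_smul, Submodule.mem_bot] at this
          exact this ha)
        (fun n => (Submodule.liftQ _ (f n) (hker n)).comp (LinearMap.fst R _ _))
        (fun n x => by
          induction x using truncCone_ind with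
          | h a b =>
          rw [truncConeDiff_mk]
          change dW n (f (n + 1) a) = f n (d n a + y ^ m • b)
          rw [hf, map_add, map_smul, hW y List.mem_cons_self, add_zero])
    have hpow : y ^ (c + m) ∈ A := by
      refine hA' _ fun n x => Prod.ext ?_ ?_
      · obtain ⟨a, b⟩ := x
        obtain ⟨a, rfl⟩ := Submodule.Quotient.mk_surjective _ a
        exact (Submodule.Quotient.mk_eq_zero _).2 (mem_span_singleton_smul_top.2 ⟨a, rfl⟩)
      · obtain ⟨a, b⟩ := x
        obtain ⟨b, rfl⟩ := Submodule.Quotient.mk_surjective _ b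
        exact (Submodule.Quotient.mk_eq_zero _).2
          (mem_span_singleton_smul_top.2 ⟨y ^ m • b, by rw [smul_smul, ← pow_add]⟩)
    refine ⟨Y, iY₁, iY₂, dY, r', A,
      fun n => (u n).comp ((LinearMap.inl R _ _).comp (Submodule.mkQ _)), v, hYex, ?_, hv, ?_,
      hA, ?_, ?_⟩
    · intro n x
      refine (hu n _).trans (congrArg (u n) ?_)
      change truncConeDiff d y c m n (Submodule.Quotient.mk x, Submodule.Quotient.mk 0) = _
      rw [truncConeDiff_mk]
      simp
    · intro n x
      exact huv n _
    · intro s hs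
      refine hA' s fun n x => ?_
      obtain ⟨a, b⟩ := x
      obtain ⟨a, rfl⟩ := Submodule.Quotient.mk_surjective _ a
      obtain ⟨b, rfl⟩ := Submodule.Quotient.mk_surjective _ b
      refine Prod.ext ?_ ?_
      · exact (congrArg Submodule.Quotient.mk (hs n a)).trans rfl
      · exact (congrArg Submodule.Quotient.mk (hs (n - 1) b)).trans rfl
    · intro z hz
      rcases List.mem_cons.1 hz with rfl | hz
      · exact ⟨_, hpow⟩
      · exact hl z hz

/-- The transition map `X / J ^ i → X / J ^ m` of a uniformly stable acyclic complex factors, for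
some `i`, through a complex of `R / J ^ i`-modules which is exact in high degrees. -/
theorem exists_factorization_factorPow [IsNoetherianRing R] (J : Ideal R)
    (d : ∀ n, X (n + 1) →ₗ[R] X n) (hd : ∀ n x, d n (d (n + 1) x) = 0)
    (hX : UniformlyStable (R := R) X)
    (hex : ∀ n x, d n x = 0 → ∃ w, d (n + 1) w = x) (m : ℕ) :
    ∃ (i : ℕ) (hi : m ≤ i) (r : ℕ) (Y : ℕ → Type v) (_ : ∀ n, AddCommGroup (Y n))
        (_ : ∀ n, Module R (Y n)) (dY : ∀ n, Y (n + 1) →ₗ[R] Y n)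
        (u : ∀ n, (X n ⧸ (J ^ i • ⊤ : Submodule R (X n))) →ₗ[R] Y n)
        (v : ∀ n, Y n →ₗ[R] X n ⧸ (J ^ m • ⊤ : Submodule R (X n))),
        (∀ n, r ≤ n → ∀ x, dY n x = 0 → ∃ w, dY (n + 1) w = x) ∧
        (∀ n x, dY n (u (n + 1) x) = u n (mapQPow J i (d n) x)) ∧
        (∀ n x, mapQPow J m (d n) (v (n + 1) x) = v n (dY n x)) ∧
        (∀ n x, v n (u n x) = Submodule.factorPow J (X n) hi x) ∧
        (∀ s ∈ J ^ i, ∀ n (x : Y n), s • x = 0) := by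
  obtain ⟨S, hS⟩ := (isNoetherian_def.1 (inferInstance : IsNoetherian R R)) J
  obtain ⟨Y, iY₁, iY₂, dY, r, A, u, v, hYex, hu, hv, huv, hA, -, hl⟩ :=
    exists_factorization_of_list m (W := fun n => X n ⧸ (J ^ m • ⊤ : Submodule R (X n)))
      (fun n => mapQPow J m (d n)) S.toList
      (fun y hy n x => smul_quotient_eq_zero J le_rfl (Ideal.pow_mem_pow (by
        rw [← hS]
        exact Submodule.subset_span (Finset.mem_toList.1 hy)) m) x)
      X d hd hX 0 (fun n _ => hex n) (fun n => Submodule.mkQ _) (fun n x => rfl)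
  obtain ⟨k, hk⟩ := Ideal.exists_pow_le_of_le_radical_of_fg (I := J) (J := A) (by
    rw [← hS]
    exact Submodule.span_le.2 fun y hy => hl y (Finset.mem_toList.2 hy)) ⟨S, hS⟩
  have hkill : ∀ s ∈ J ^ (m + k), ∀ n (x : Y n), s • x = 0 := fun s hs n x =>
    hA s (hk (Ideal.pow_le_pow_right (Nat.le_add_left _ _) hs)) n x
  refine ⟨m + k, Nat.le_add_right _ _, r, Y, iY₁, iY₂, dY,
    fun n => Submodule.liftQ _ (u n) (Submodule.smul_le.2 fun s hs x _ => ?_), v, hYex, ?_, hv,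
    ?_, hkill⟩
  · rw [LinearMap.mem_ker, map_smul, hkill s hs]
  · intro n x
    obtain ⟨x, rfl⟩ := Submodule.Quotient.mk_surjective _ x
    exact hu n x
  · intro n x
    obtain ⟨x, rfl⟩ := Submodule.Quotient.mk_surjective _ x
    exact huv n x

end Cone

section Lifting

variable {R : Type u} [CommRing R]

theorem exists_lift_of_projective {P A B : Type*} [AddCommGroup P] [Module R P]
    [AddCommGroup A] [Module R A] [AddCommGroup B] [Module R B] [Module.Projective R P]
    (f : A →ₗ[R] B) (h : P →ₗ[R] B) (hfh : ∀ x, h x ∈ LinearMap.range f) :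
    ∃ l : P →ₗ[R] A, f.comp l = h := by
  obtain ⟨l, hl⟩ := Module.projective_lifting_property f.rangeRestrict (h.codRestrict _ hfh)
    f.surjective_rangeRestrict
  refine ⟨l, ?_⟩
  ext x
  exact congrArg Subtype.val (LinearMap.congr_fun hl x)

theorem exists_finite_free_resolution [IsNoetherianRing R] (M : Type v) [AddCommGroup M]
    [Module R M] [Module.Finite R M] :
    ∃ (k : ℕ → ℕ) (e : (Fin (k 0) → R) →ₗ[R] M)
      (d : ∀ n, (Fin (k (n + 1)) → R) →ₗ[R] (Fin (k n) → R)),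
      Function.Surjective e ∧ LinearMap.ker e = LinearMap.range (d 0) ∧
        ∀ n, LinearMap.ker (d n) = LinearMap.range (d (n + 1)) := by
  have cover : ∀ (a : ℕ) (N : Submodule R (Fin a → R)),
      ∃ (b : ℕ) (g : (Fin b → R) →ₗ[R] (Fin a → R)), N = LinearMap.range g := by
    intro a N
    obtain ⟨b, g, hg⟩ := Module.Finite.exists_fin' R N
    refine ⟨b, N.subtype.comp g, ?_⟩
    rw [LinearMap.range_comp, LinearMap.range_eq_top.2 hg, Submodule.map_top,
      Submodule.range_subtype]
  obtain ⟨a, e, he⟩ := Module.Finite.exists_fin' R M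
  choose c g hg using cover
  let S : ℕ → (Σ a b : ℕ, (Fin b → R) →ₗ[R] (Fin a → R)) := fun n =>
    Nat.rec ⟨a, c a (LinearMap.ker e), g a (LinearMap.ker e)⟩
      (fun _ s => ⟨s.2.1, c s.2.1 (LinearMap.ker s.2.2), g s.2.1 (LinearMap.ker s.2.2)⟩) n
  exact ⟨fun n => (S n).1, e, fun n => (S n).2.2, he, hg a (LinearMap.ker e),
    fun n => hg (S n).2.1 (LinearMap.ker (S n).2.2)⟩

theorem exists_chain_lift_of_projective {M : Type*} [AddCommGroup M] [Module R M]
    {F : ℕ → Type*} [∀ n, AddCommGroup (F n)] [∀ n, Module R (F n)]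
    [∀ n, Module.Projective R (F n)]
    {L : ℕ → Type*} [∀ n, AddCommGroup (L n)] [∀ n, Module R (L n)]
    (e : F 0 →ₗ[R] M) (d : ∀ n, F (n + 1) →ₗ[R] F n) (hed : ∀ x, e (d 0 x) = 0)
    (hd : ∀ n x, d n (d (n + 1) x) = 0)
    (ε : L 0 →ₗ[R] M) (dL : ∀ n, L (n + 1) →ₗ[R] L n) (hε : Function.Surjective ε)
    (hex0 : LinearMap.ker ε = LinearMap.range (dL 0))
    (hex : ∀ n, LinearMap.ker (dL n) = LinearMap.range (dL (n + 1))) :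
    ∃ θ : ∀ n, F n →ₗ[R] L n, ε.comp (θ 0) = e ∧
      ∀ n, (dL n).comp (θ (n + 1)) = (θ n).comp (d n) := by
  obtain ⟨a, ha⟩ := exists_lift_of_projective ε e fun x => hε (e x)
  obtain ⟨b, hb⟩ := exists_lift_of_projective (dL 0) (a.comp (d 0)) fun x => by
    rw [← hex0, LinearMap.mem_ker, LinearMap.comp_apply, ← LinearMap.comp_apply, ha, hed]
  obtain ⟨θ, hθ, hθ'⟩ := exists_extend_solution (β := fun n => F n →ₗ[R] L n)
    (fun n a b => (dL n).comp b = a.comp (d n)) 0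
    (fun n _ a b hab => exists_lift_of_projective _ _ fun x => by
      rw [← hex, LinearMap.mem_ker, LinearMap.comp_apply, ← LinearMap.comp_apply, hab,
        LinearMap.comp_apply, hd, map_zero])
    (Function.update (Function.update (fun _ => 0) 0 a) 1 b)
    (fun k hk => by
      obtain rfl : k = 0 := by omega
      rw [Function.update_self, Function.update_of_ne (by omega), Function.update_self]
      exact hb)
  refine ⟨θ, ?_, hθ'⟩
  rw [hθ 0 (by omega), Function.update_of_ne (by omega), Function.update_self, ha]

variable [IsNoetherianRing R] (J : Ideal R) {M : Type v} [AddCommGroup M] [Module R M]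
  [Module.Finite R M] {F : ℕ → Type u} [∀ n, AddCommGroup (F n)] [∀ n, Module R (F n)]
  [∀ n, Module.Finite R (F n)]

/-- The cycles of the augmented complex `F ∗ / J ^ m → M / J ^ m`. -/
def IsCycle (e : F 0 →ₗ[R] M) (d : ∀ n, F (n + 1) →ₗ[R] F n) (m : ℕ) :
    ∀ n, (F n ⧸ (J ^ m • ⊤ : Submodule R (F n))) → Prop
  | 0, z => mapQPow J m e z = 0
  | n + 1, z => mapQPow J m (d n) z = 0

theorem exists_level_isCycle (e : F 0 →ₗ[R] M) (d : ∀ n, F (n + 1) →ₗ[R] F n)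
    (hex0 : ∀ x, e x = 0 → ∃ w, d 0 w = x) (hex : ∀ n x, d n x = 0 → ∃ w, d (n + 1) w = x)
    (n m : ℕ) :
    ∃ (m' : ℕ) (h : m ≤ m'), ∀ z, IsCycle J e d m' n z →
      Submodule.factorPow J (F n) h z ∈ LinearMap.range (mapQPow J m (d n)) := by
  cases n with
  | zero => exact exists_factorPow_mem_range J (d 0) e hex0 m
  | succ n => exact exists_factorPow_mem_range J (d (n + 1)) (d n) (hex n) m

/-- For every `m`, an augmented complex of projective `R / J ^ j`-modules with `j` large maps to
`F ∗ / J ^ m` over `M / J ^ m`; the bound on `j` is uniform in all degrees. -/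
theorem exists_chain_lift_of_le (e : F 0 →ₗ[R] M) (d : ∀ n, F (n + 1) →ₗ[R] F n)
    (he : Function.Surjective e) (hd : ∀ n x, d n (d (n + 1) x) = 0)
    (hex0 : ∀ x, e x = 0 → ∃ w, d 0 w = x) (hex : ∀ n x, d n x = 0 → ∃ w, d (n + 1) w = x)
    (hF : UniformlyStable (R := R) F) (m : ℕ) :
    ∃ (i : ℕ) (hi : m ≤ i), ∀ (j : ℕ) (hj : i ≤ j)
      (P : ℕ → Type w) [∀ n, AddCommGroup (P n)] [∀ n, Module R (P n)]
      (dP : ∀ n, P (n + 1) →ₗ[R] P n) (_ : ∀ n x, dP n (dP (n + 1) x) = 0)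
      (htors : ∀ n, Module.IsTorsionBySet R (P n) ((J ^ j : Ideal R) : Set R))
      (_ : ∀ n, letI := (htors n).module; Module.Projective (R ⧸ J ^ j) (P n))
      (g : P 0 →ₗ[R] M ⧸ (J ^ j • ⊤ : Submodule R M)) (_ : ∀ x, g (dP 0 x) = 0),
      ∃ f : ∀ n, P n →ₗ[R] F n ⧸ (J ^ m • ⊤ : Submodule R (F n)),
        (∀ n x, mapQPow J m (d n) (f (n + 1) x) = f n (dP n x)) ∧
        ∀ x, mapQPow J m e (f 0 x) = Submodule.factorPow J M (hi.trans hj) (g x) := by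
  choose s hs hsZ using exists_level_isCycle J e d hex0 hex
  obtain ⟨i, hi, r, Y, iY₁, iY₂, dY, u, v, hYex, hu, hv, huv, hkill⟩ :=
    exists_factorization_factorPow J d hd hF hex m
  have hl := le_startLevel hs (r + 1) i
  refine ⟨startLevel s (r + 1) i, hi.trans hl, ?_⟩
  intro j hj P _ _ dP hdP htors hproj g hg
  obtain ⟨f, hf, -, hf0⟩ := exists_partial_solution
    (α := fun m k => P k →ₗ[R] F k ⧸ (J ^ m • ⊤ : Submodule R (F k)))
    (fun h k a => (Submodule.factorPow J (F k) h).comp a) j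
    (fun m _ k a b => ∀ x, mapQPow J m (d k) (b x) = a (dP k x))
    (fun m _ k a => ∀ x, IsCycle J e d m k (a (dP k x)))
    (fun m h a => ∀ x, mapQPow J m e (a x) = Submodule.factorPow J M h (g x)) s hs
    (fun m m' h h' k a b hab x => by
      simp only [LinearMap.comp_apply]
      rw [mapQPow_factorPow, hab])
    (fun m m' h h' a ha x => by
      simp only [LinearMap.comp_apply]
      rw [mapQPow_factorPow, ha, factorPow_factorPow])
    (fun m h => by
      obtain ⟨a, ha⟩ := exists_lift_of_isTorsionBySet (J ^ j) (htors 0) (hproj 0)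
        (fun s hs a => smul_quotient_eq_zero J h hs a) (mapQPow J m e)
        ((Submodule.factorPow J M h).comp g) (fun x => by
          obtain ⟨y, hy⟩ := Submodule.Quotient.mk_surjective _
            ((Submodule.factorPow J M h).comp g x)
          obtain ⟨z, rfl⟩ := he y
          exact ⟨Submodule.Quotient.mk z, hy⟩)
      have ha' := LinearMap.congr_fun ha
      refine ⟨a, fun x => ?_, ha'⟩
      refine (ha' (dP 0 x)).trans ?_
      rw [LinearMap.comp_apply, hg, map_zero])
    (fun N m h a ha => by
      obtain ⟨c, hc⟩ := exists_lift_of_isTorsionBySet (J ^ j) (htors (N + 1)) (hproj (N + 1))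
        (fun s' hs' a => smul_quotient_eq_zero J ((hs N m).trans h) hs' a) (mapQPow J m (d N))
        (((Submodule.factorPow J (F N) (hs N m)).comp a).comp (dP N))
        (fun x => hsZ N m _ (ha x))
      have hc' := LinearMap.congr_fun hc
      refine ⟨c, hc', fun x => ?_⟩
      refine (hc' (dP (N + 1) x)).trans ?_
      rw [LinearMap.comp_apply, hdP, map_zero])
    (r + 1) i hj
  obtain ⟨f', hf', hff'⟩ := exists_extend_solution (β := fun k => P k →ₗ[R] Y k)
    (fun k a b => ∀ x, dY k (b x) = a (dP k x)) r
    (fun n hn a b hab => by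
      obtain ⟨c, hc⟩ := exists_lift_of_isTorsionBySet (J ^ j) (htors (n + 2)) (hproj (n + 2))
        (fun s hs y => hkill s (Ideal.pow_le_pow_right (hl.trans hj) hs) _ y) (dY (n + 1))
        (b.comp (dP (n + 1))) (fun x => hYex n hn _ (by
          rw [LinearMap.comp_apply, hab, hdP, map_zero]))
      exact ⟨c, LinearMap.congr_fun hc⟩)
    (fun k => (u k).comp (f k)) (fun k hk x => by
      rw [LinearMap.comp_apply, hu, hf k hk, LinearMap.comp_apply])
  refine ⟨fun k => (v k).comp (f' k), fun n x => ?_, fun x => ?_⟩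
  · rw [LinearMap.comp_apply, hv, hff', LinearMap.comp_apply]
  · rw [LinearMap.comp_apply, hf' 0 (Nat.zero_le _), LinearMap.comp_apply, huv,
      mapQPow_factorPow, hf0, factorPow_factorPow]

/-- For every `m`, a chain map over zero from a complex of projective `R / J ^ j`-modules to
`F ∗ / J ^ i` with `i` large becomes nullhomotopic in `F ∗ / J ^ m`. -/
theorem exists_nullhomotopy_of_le (e : F 0 →ₗ[R] M) (d : ∀ n, F (n + 1) →ₗ[R] F n)
    (he : Function.Surjective e) (hd : ∀ n x, d n (d (n + 1) x) = 0)
    (hex0 : ∀ x, e x = 0 → ∃ w, d 0 w = x) (hex : ∀ n x, d n x = 0 → ∃ w, d (n + 1) w = x)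
    (hF : UniformlyStable (R := R) F) (m : ℕ) :
    ∃ (i : ℕ) (hi : m ≤ i), ∀ (j : ℕ) (_ : i ≤ j)
      (P : ℕ → Type w) [∀ n, AddCommGroup (P n)] [∀ n, Module R (P n)]
      (dP : ∀ n, P (n + 1) →ₗ[R] P n) (_ : ∀ n x, dP n (dP (n + 1) x) = 0)
      (htors : ∀ n, Module.IsTorsionBySet R (P n) ((J ^ j : Ideal R) : Set R))
      (_ : ∀ n, letI := (htors n).module; Module.Projective (R ⧸ J ^ j) (P n))
      (δ : ∀ n, P n →ₗ[R] F n ⧸ (J ^ i • ⊤ : Submodule R (F n)))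
      (_ : ∀ n x, mapQPow J i (d n) (δ (n + 1) x) = δ n (dP n x))
      (_ : ∀ x, mapQPow J i e (δ 0 x) = 0),
      ∃ h : ∀ n, P n →ₗ[R] F (n + 1) ⧸ (J ^ m • ⊤ : Submodule R (F (n + 1))),
        (∀ x, mapQPow J m (d 0) (h 0 x) = Submodule.factorPow J (F 0) hi (δ 0 x)) ∧
        ∀ n x, mapQPow J m (d (n + 1)) (h (n + 1) x) + h n (dP n x)
          = Submodule.factorPow J (F (n + 1)) hi (δ (n + 1) x) := by
  choose s₀ hs₀ hsZ using exists_level_isCycle J e d hex0 hex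
  let s : ℕ → ℕ → ℕ := fun n m => s₀ (n + 1) m
  have hs : ∀ n m, m ≤ s n m := fun n m => hs₀ (n + 1) m
  obtain ⟨i, hi, r, Y, iY₁, iY₂, dY, u, v, hYex, hu, hv, huv, hkill⟩ :=
    exists_factorization_factorPow J d hd hF hex m
  have hl := le_startLevel hs (r + 1) i
  refine ⟨startLevel s (r + 1) i, hi.trans hl, ?_⟩
  generalize hi₀ : startLevel s (r + 1) i = i₀ at hl
  intro j hj P _ _ dP hdP htors hproj δ hδ hδ0
  obtain ⟨f, hf, -, hf0⟩ := exists_partial_solution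
    (α := fun m k => P k →ₗ[R] F (k + 1) ⧸ (J ^ m • ⊤ : Submodule R (F (k + 1))))
    (fun h k a => (Submodule.factorPow J (F (k + 1)) h).comp a) i₀
    (fun m h k a b => ∀ x, mapQPow J m (d (k + 1)) (b x) + a (dP k x)
      = Submodule.factorPow J (F (k + 1)) h (δ (k + 1) x))
    (fun m h k a => ∀ x, mapQPow J m (d k)
      (Submodule.factorPow J (F (k + 1)) h (δ (k + 1) x) - a (dP k x)) = 0)
    (fun m h a => ∀ x, mapQPow J m (d 0) (a x) = Submodule.factorPow J (F 0) h (δ 0 x)) s hs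
    (fun m m' h h' k a b hab x => by
      simp only [LinearMap.comp_apply]
      rw [mapQPow_factorPow, ← map_add, hab, factorPow_factorPow])
    (fun m m' h h' a ha x => by
      simp only [LinearMap.comp_apply]
      rw [mapQPow_factorPow, ha, factorPow_factorPow])
    (fun m h => by
      obtain ⟨a, ha⟩ := exists_lift_of_isTorsionBySet (J ^ j) (htors 0) (hproj 0)
        (fun s hs a => smul_quotient_eq_zero J (h.trans hj) hs a) (mapQPow J m (d 0))
        ((Submodule.factorPow J (F 0) h).comp (δ 0)) (fun x =>
          mem_range_mapQPow_of_surjective J m (d 0) e he hex0 _ (by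
            rw [LinearMap.comp_apply, mapQPow_factorPow, hδ0, map_zero]))
      have ha' := LinearMap.congr_fun ha
      refine ⟨a, fun x => ?_, ha'⟩
      rw [map_sub, mapQPow_factorPow, hδ, sub_eq_zero]
      exact (ha' (dP 0 x)).symm)
    (fun N m h a ha => by
      obtain ⟨c, hc⟩ := exists_lift_of_isTorsionBySet (J ^ j) (htors (N + 1)) (hproj (N + 1))
        (fun s' hs' a => smul_quotient_eq_zero J (((hs N m).trans h).trans hj) hs' a)
        (mapQPow J m (d (N + 1)))
        ((Submodule.factorPow J (F (N + 1)) (hs N m)).comp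
          ((Submodule.factorPow J (F (N + 1)) h).comp (δ (N + 1)) - a.comp (dP N)))
        (fun x => hsZ (N + 1) m _ (ha x))
      have hc' : ∀ x, mapQPow J m (d (N + 1)) (c x)
          = Submodule.factorPow J (F (N + 1)) ((hs N m).trans h) (δ (N + 1) x)
            - Submodule.factorPow J (F (N + 1)) (hs N m) (a (dP N x)) := fun x => by
        refine (LinearMap.congr_fun hc x).trans ?_
        rw [LinearMap.comp_apply, LinearMap.sub_apply, map_sub, LinearMap.comp_apply,
          factorPow_factorPow, LinearMap.comp_apply]
      refine ⟨c, fun x => ?_, fun x => ?_⟩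
      · rw [hc', LinearMap.comp_apply, sub_add_cancel]
      · rw [map_sub, mapQPow_factorPow, hδ, hc', hdP, map_zero, map_zero, sub_zero, sub_self])
    (r + 1) i hi₀.le
  obtain ⟨f', hf', hff'⟩ := exists_extend_solution (β := fun k => P k →ₗ[R] Y (k + 1))
    (fun k a b => ∀ x, dY (k + 1) (b x) + a (dP k x)
      = u (k + 1) (Submodule.factorPow J (F (k + 1)) hl (δ (k + 1) x))) r
    (fun n hn a b hab => by
      obtain ⟨c, hc⟩ := exists_lift_of_isTorsionBySet (J ^ j) (htors (n + 2)) (hproj (n + 2))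
        (fun s hs y => hkill s (Ideal.pow_le_pow_right (hl.trans hj) hs) _ y) (dY (n + 2))
        ((u (n + 2)).comp ((Submodule.factorPow J (F (n + 2)) hl).comp (δ (n + 2)))
          - b.comp (dP (n + 1)))
        (fun x => hYex (n + 1) (by omega) _ (by
          have := hab (dP (n + 1) x)
          rw [hdP, map_zero, add_zero] at this
          simp only [LinearMap.sub_apply, LinearMap.comp_apply]
          rw [map_sub, this, hu, mapQPow_factorPow, hδ, sub_self]))
      refine ⟨c, fun x => ?_⟩
      have := LinearMap.congr_fun hc x
      rw [LinearMap.comp_apply] at this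
      rw [this]
      simp)
    (fun k => (u (k + 1)).comp (f k)) (fun k hk x => by
      rw [LinearMap.comp_apply, hu, LinearMap.comp_apply, ← map_add, hf k hk])
  refine ⟨fun k => (v (k + 1)).comp (f' k), fun x => ?_, fun n x => ?_⟩
  · rw [LinearMap.comp_apply, hf' 0 (Nat.zero_le _), LinearMap.comp_apply, huv,
      mapQPow_factorPow, hf0, factorPow_factorPow]
  · rw [LinearMap.comp_apply, hv, LinearMap.comp_apply, ← map_add, hff', huv,
      factorPow_factorPow]

end Lifting

section HomotopyBoundary

variable {R : Type u} [CommRing R]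
  {P P' X X' : ℕ → Type*} [∀ n, AddCommGroup (P n)] [∀ n, Module R (P n)]
  [∀ n, AddCommGroup (P' n)] [∀ n, Module R (P' n)]
  [∀ n, AddCommGroup (X n)] [∀ n, Module R (X n)]
  [∀ n, AddCommGroup (X' n)] [∀ n, Module R (X' n)]

/-- The chain map `d κ + κ d` attached to a family `κ` of maps of degree one. -/
def homotopyBoundary (dX : ∀ n, X (n + 1) →ₗ[R] X n) (dP : ∀ n, P (n + 1) →ₗ[R] P n)
    (κ : ∀ n, P n →ₗ[R] X (n + 1)) : ∀ n, P n →ₗ[R] X n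
  | 0 => (dX 0).comp (κ 0)
  | n + 1 => (dX (n + 1)).comp (κ (n + 1)) + (κ n).comp (dP n)

theorem homotopyBoundary_comm {dX : ∀ n, X (n + 1) →ₗ[R] X n} {dP : ∀ n, P (n + 1) →ₗ[R] P n}
    (hX : ∀ n x, dX n (dX (n + 1) x) = 0) (hP : ∀ n x, dP n (dP (n + 1) x) = 0)
    (κ : ∀ n, P n →ₗ[R] X (n + 1)) (n : ℕ) (x : P (n + 1)) :
    dX n (homotopyBoundary dX dP κ (n + 1) x) = homotopyBoundary dX dP κ n (dP n x) := by
  cases n <;> simp [homotopyBoundary, hX, hP]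

theorem map_homotopyBoundary {dX : ∀ n, X (n + 1) →ₗ[R] X n} {dX' : ∀ n, X' (n + 1) →ₗ[R] X' n}
    {dP : ∀ n, P (n + 1) →ₗ[R] P n} {dP' : ∀ n, P' (n + 1) →ₗ[R] P' n}
    (p : ∀ n, X' n →ₗ[R] X n) (hp : ∀ n x, dX n (p (n + 1) x) = p n (dX' n x))
    (s : ∀ n, P' n →ₗ[R] P n) (hs : ∀ n x, dP n (s (n + 1) x) = s n (dP' n x))
    (κ : ∀ n, P n →ₗ[R] X (n + 1)) (κ' : ∀ n, P' n →ₗ[R] X' (n + 1))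
    (h : ∀ n, P' n →ₗ[R] X (n + 1)) (hκ : ∀ n x, p (n + 1) (κ' n x) = h n x + κ n (s n x))
    (n : ℕ) (x : P' n) :
    p n (homotopyBoundary dX' dP' κ' n x)
      = homotopyBoundary dX dP' h n x + homotopyBoundary dX dP κ n (s n x) := by
  cases n with
  | zero => simp [homotopyBoundary, ← hp, hκ]
  | succ n =>
    simp only [homotopyBoundary, LinearMap.add_apply, LinearMap.comp_apply, map_add, ← hp, hκ, hs]
    abel

end HomotopyBoundary

section TowerLift

variable {R : Type u} [CommRing R] [IsNoetherianRing R] (J : Ideal R) {M : Type v}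
  [AddCommGroup M] [Module R M] [Module.Finite R M]
  {F : ℕ → Type u} [∀ n, AddCommGroup (F n)] [∀ n, Module R (F n)] [∀ n, Module.Finite R (F n)]

theorem exists_tower_lift (e : F 0 →ₗ[R] M) (d : ∀ n, F (n + 1) →ₗ[R] F n)
    (he : Function.Surjective e) (hed : ∀ x, e (d 0 x) = 0) (hd : ∀ n x, d n (d (n + 1) x) = 0)
    (hex0 : ∀ x, e x = 0 → ∃ w, d 0 w = x) (hex : ∀ n x, d n x = 0 → ∃ w, d (n + 1) w = x)
    (hF : UniformlyStable (R := R) F)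
    (P : ℕ → ℕ → Type w) [∀ n m, AddCommGroup (P n m)] [∀ n m, Module R (P n m)]
    (dP : ∀ n m, P (n + 1) m →ₗ[R] P n m) (hdP : ∀ n m x, dP n m (dP (n + 1) m x) = 0)
    (t : ∀ n m, P n (m + 1) →ₗ[R] P n m)
    (ht : ∀ n m, (dP n m).comp (t (n + 1) m) = (t n m).comp (dP n (m + 1)))
    (htors : ∀ n m, Module.IsTorsionBySet R (P n m) ((J ^ m : Ideal R) : Set R))
    (hproj : ∀ n m, letI := (htors n m).module; Module.Projective (R ⧸ J ^ m) (P n m))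
    (g : ∀ m, P 0 m →ₗ[R] M ⧸ (J ^ m • ⊤ : Submodule R M))
    (hgd : ∀ m x, g m (dP 0 m x) = 0)
    (hgt : ∀ m, (transQPow J m M).comp (g (m + 1)) = (g m).comp (t 0 m)) :
    ∃ (i : ℕ → ℕ) (hi : StrictMono i)
      (φ : ∀ n m, P n (i m) →ₗ[R] F n ⧸ (J ^ m • ⊤ : Submodule R (F n))),
      (∀ n m x, mapQPow J m (d n) (φ (n + 1) m x) = φ n m (dP n (i m) x)) ∧
      (∀ n m x, transQPow J m (F n) (φ n (m + 1) x)
        = φ n m (towerMap (t n) (hi (Nat.lt_succ_self m)).le x)) ∧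
      ∀ m x, mapQPow J m e (φ 0 m x) = Submodule.factorPow J M hi.le_apply (g (i m) x) := by
  choose l hl hlift using exists_chain_lift_of_le.{u, v, w} J e d he hd hex0 hex hF
  choose c hc hnull using exists_nullhomotopy_of_le.{u, v, w} J e d he hd hex0 hex hF
  let q : ℕ → ℕ := fun m => ∑ k ∈ Finset.range (m + 1), c k
  have hcq : ∀ m, c m ≤ q m := fun m =>
    Finset.single_le_sum (f := c) (fun _ _ => Nat.zero_le _) (Finset.self_mem_range_succ m)
  have hmq : ∀ m, m ≤ q m := fun m => (hc m).trans (hcq m)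
  have hqq : ∀ m, q m ≤ q (m + 1) := fun m => by
    simp only [q, Finset.sum_range_succ _ (m + 1)]
    exact Nat.le_add_right _ _
  let i : ℕ → ℕ := fun m => m + ∑ k ∈ Finset.range (m + 1), l (q k)
  have hi : StrictMono i := strictMono_nat_of_lt_succ fun m => by
    simp only [i, Finset.sum_range_succ _ (m + 1)]
    omega
  have hli : ∀ m, l (q m) ≤ i m := fun m =>
    (Finset.single_le_sum (f := fun k => l (q k)) (fun _ _ => Nat.zero_le _)
      (Finset.self_mem_range_succ m)).trans (Nat.le_add_left _ _)
  have hqi : ∀ m, q m ≤ i m := fun m => (hl (q m)).trans (hli m)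
  have hii : ∀ m, i m ≤ i (m + 1) := fun m => (hi (Nat.lt_succ_self m)).le
  choose f hf hf0 using fun m => hlift (q m) (i m) (hli m) (fun n => P n (i m))
    (fun n => dP n (i m)) (fun n x => hdP n (i m) x) (fun n => htors n (i m))
    (fun n => hproj n (i m)) (g (i m)) (hgd (i m))
  let T : ∀ m n, P n (i (m + 1)) →ₗ[R] P n (i m) := fun m n => towerMap (t n) (hii m)
  have hT : ∀ m n x, dP n (i m) (T m (n + 1) x) = T m n (dP n (i (m + 1)) x) := fun m n x =>
    (LinearMap.congr_fun (towerMap_natural (t (n + 1)) (t n) (dP n) (fun m => (ht n m).symm)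
      (hii m)) x).symm
  have hgT : ∀ m x, g (i m) (T m 0 x) = Submodule.factorPow J M (hii m) (g (i (m + 1)) x) :=
    fun m x => by
      rw [← towerMap_transQPow]
      exact (LinearMap.congr_fun (towerMap_natural (t 0) (fun m => transQPow J m M) g hgt
        (hii m)) x).symm
  let δ : ∀ m n, P n (i (m + 1)) →ₗ[R] F n ⧸ (J ^ c m • ⊤ : Submodule R (F n)) := fun m n =>
    (Submodule.factorPow J (F n) (hcq m)).comp ((f m n).comp (T m n)
      - (Submodule.factorPow J (F n) (hqq m)).comp (f (m + 1) n))
  have hδ : ∀ m n x, δ m n x = Submodule.factorPow J (F n) (hcq m) (f m n (T m n x))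
      - Submodule.factorPow J (F n) ((hcq m).trans (hqq m)) (f (m + 1) n x) := fun m n x => by
    simp only [δ, LinearMap.comp_apply, LinearMap.sub_apply, map_sub, factorPow_factorPow]
  choose h hh0 hh using fun m => hnull m (i (m + 1)) ((hcq m).trans ((hqi m).trans (hii m)))
    (fun n => P n (i (m + 1))) (fun n => dP n (i (m + 1))) (fun n x => hdP n (i (m + 1)) x)
    (fun n => htors n (i (m + 1))) (fun n => hproj n (i (m + 1))) (δ m)
    (fun n x => by
      simp only [hδ, map_sub, mapQPow_factorPow, hf, hT])
    (fun x => by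
      simp only [hδ, map_sub, mapQPow_factorPow, hf0, hgT, factorPow_factorPow, sub_self])
  have next : ∀ m (κ : ∀ n, P n (i m) →ₗ[R] F (n + 1) ⧸ (J ^ m • ⊤ : Submodule R (F (n + 1)))),
      ∃ κ' : ∀ n, P n (i (m + 1)) →ₗ[R] F (n + 1) ⧸ (J ^ (m + 1) • ⊤ : Submodule R (F (n + 1))),
        ∀ n x, Submodule.factorPow J (F (n + 1)) (Nat.le_succ m) (κ' n x)
          = h m n x + κ n (T m n x) := fun m κ => by
    choose κ' hκ' using fun n => exists_lift_of_isTorsionBySet (J ^ i (m + 1))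
      (htors n (i (m + 1))) (hproj n (i (m + 1)))
      (fun s hs a => smul_quotient_eq_zero J hi.le_apply hs a)
      (Submodule.factorPow J (F (n + 1)) (Nat.le_succ m)) (h m n + (κ n).comp (T m n))
      (fun x => factorPow_surjective J _ _)
    exact ⟨κ', fun n x => LinearMap.congr_fun (hκ' n) x⟩
  choose κ' hκ' using next
  let κ : ∀ m n, P n (i m) →ₗ[R] F (n + 1) ⧸ (J ^ m • ⊤ : Submodule R (F (n + 1))) := fun m =>
    Nat.rec (fun _ => 0) (fun m a => κ' m a) m
  have hκ : ∀ m n x, Submodule.factorPow J (F (n + 1)) (Nat.le_succ m) (κ (m + 1) n x)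
      = h m n x + κ m n (T m n x) := fun m => hκ' m (κ m)
  have hdd : ∀ m n x, mapQPow J m (d n) (mapQPow J m (d (n + 1)) x) = 0 := fun m n x => by
    obtain ⟨x, rfl⟩ := Submodule.Quotient.mk_surjective _ x
    rw [mapQPow_mk, mapQPow_mk, hd, Submodule.Quotient.mk_zero]
  refine ⟨i, hi, fun n m => (Submodule.factorPow J (F n) (hmq m)).comp (f m n)
    + homotopyBoundary (X := fun n => F n ⧸ (J ^ m • ⊤ : Submodule R (F n)))
      (fun n => mapQPow J m (d n)) (fun n => dP n (i m)) (κ m) n,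
    fun n m x => ?_, fun n m x => ?_, fun m x => ?_⟩
  · rw [LinearMap.add_apply, LinearMap.comp_apply, map_add, mapQPow_factorPow, hf]
    congr 1
    exact homotopyBoundary_comm (P := fun n => P n (i m))
      (X := fun n => F n ⧸ (J ^ m • ⊤ : Submodule R (F n))) (hdd m)
      (fun n x => hdP n (i m) x) (κ m) n x
  · have hb := map_homotopyBoundary
      (X := fun n => F n ⧸ (J ^ m • ⊤ : Submodule R (F n)))
      (X' := fun n => F n ⧸ (J ^ (m + 1) • ⊤ : Submodule R (F n)))
      (dX := fun n => mapQPow J m (d n)) (dX' := fun n => mapQPow J (m + 1) (d n))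
      (dP := fun n => dP n (i m)) (dP' := fun n => dP n (i (m + 1)))
      (fun n => Submodule.factorPow J (F n) (Nat.le_succ m))
      (fun n x => mapQPow_factorPow J _ _ x) (T m) (hT m) (κ m) (κ (m + 1)) (h m) (hκ m) n x
    have hhb : homotopyBoundary (X := fun n => F n ⧸ (J ^ m • ⊤ : Submodule R (F n)))
        (fun n => mapQPow J m (d n)) (fun n => dP n (i (m + 1))) (h m) n x
        = Submodule.factorPow J (F n) (hc m) (δ m n x) := by
      cases n with
      | zero => exact hh0 m x
      | succ n => exact hh m n x
    rw [hhb, hδ, map_sub, factorPow_factorPow, factorPow_factorPow] at hb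
    rw [transQPow_eq_factorPow, LinearMap.add_apply, LinearMap.comp_apply, map_add,
      factorPow_factorPow, hb, LinearMap.add_apply, LinearMap.comp_apply]
    simp only [T]
    abel
  · have hb : mapQPow J m e (mapQPow J m (d 0) (κ m 0 x)) = 0 := by
      obtain ⟨y, hy⟩ := Submodule.Quotient.mk_surjective _ (κ m 0 x)
      rw [← hy, mapQPow_mk, mapQPow_mk, hed, Submodule.Quotient.mk_zero]
    rw [LinearMap.add_apply, map_add, LinearMap.comp_apply, mapQPow_factorPow, hf0,
      factorPow_factorPow]
    exact (congrArg _ hb).trans (add_zero _)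

end TowerLift

/-- **Comparison theorem for pro-complexes (existence part).**
Let `R` be noetherian, `J ⊆ R` an ideal, `M` finitely generated, and
`⋯ → L 1 → L 0 → M → 0` an exact sequence of finitely generated `R`-modules.
Let `(P ∗ m)` be a tower of non-negatively graded chain complexes with `J^m • P n m = 0`
and each `P n m` projective over `R/J^m`, and let `g m : P 0 m → M/J^m M` be compatible
with transitions and kill the image of `P 1 m → P 0 m`.  Then after a strictly
increasing reindexing `i` there are chain maps `φ ∗ m : P ∗ (i m) → L ∗/J^m L ∗`,
compatible with the transition maps of the towers, lifting `g`. -/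
theorem exists_chain_lift_of_pro_resolution [IsNoetherianRing R] (J : Ideal R)
    {M : Type*} [AddCommGroup M] [Module R M] [Module.Finite R M]
    (L : ℕ → Type*) [∀ n, AddCommGroup (L n)] [∀ n, Module R (L n)]
    [∀ n, Module.Finite R (L n)]
    (ε : L 0 →ₗ[R] M) (d : ∀ n, L (n + 1) →ₗ[R] L n)
    (hsurj : Function.Surjective ε)
    (hex0 : LinearMap.ker ε = LinearMap.range (d 0))
    (hex : ∀ n, LinearMap.ker (d n) = LinearMap.range (d (n + 1)))
    (P : ℕ → ℕ → Type*) [∀ n m, AddCommGroup (P n m)] [∀ n m, Module R (P n m)]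
    (dP : ∀ n m, P (n + 1) m →ₗ[R] P n m)
    (hdP : ∀ n m, (dP n m).comp (dP (n + 1) m) = 0)
    (t : ∀ n m, P n (m + 1) →ₗ[R] P n m)
    (ht : ∀ n m, (dP n m).comp (t (n + 1) m) = (t n m).comp (dP n (m + 1)))
    (htors : ∀ n m, Module.IsTorsionBySet R (P n m) ((J ^ m : Ideal R) : Set R))
    (hproj : ∀ n m, letI := (htors n m).module; Module.Projective (R ⧸ J ^ m) (P n m))
    (g : ∀ m, P 0 m →ₗ[R] M ⧸ (J ^ m • ⊤ : Submodule R M))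
    (hgd : ∀ m, (g m).comp (dP 0 m) = 0)
    (hgt : ∀ m, (transQPow J m M).comp (g (m + 1)) = (g m).comp (t 0 m)) :
    ∃ (i : ℕ → ℕ) (hi : StrictMono i)
      (φ : ∀ n m, P n (i m) →ₗ[R] (L n) ⧸ (J ^ m • ⊤ : Submodule R (L n))),
      -- each `φ ∗ m` is a chain map
      (∀ n m, (mapQPow J m (d n)).comp (φ (n + 1) m) = (φ n m).comp (dP n (i m))) ∧
      -- the `φ` are compatible with the transition maps of the two towers
      (∀ n m, (transQPow J m (L n)).comp (φ n (m + 1))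
        = (φ n m).comp (towerMap (t n) (hi (Nat.lt_succ_self m)).le)) ∧
      -- `φ` lifts `g`
      (∀ m, (mapQPow J m ε).comp (φ 0 m)
        = (towerMap (P := fun m => M ⧸ (J ^ m • ⊤ : Submodule R M))
            (fun m => transQPow J m M) hi.le_apply).comp (g (i m))) := by
  obtain ⟨k, e, D, he, hk0, hk⟩ := exists_finite_free_resolution (R := R) M
  have hed : ∀ x, e (D 0 x) = 0 := fun x => hk0.ge ⟨x, rfl⟩
  have hD : ∀ n x, D n (D (n + 1) x) = 0 := fun n x => (hk n).ge ⟨x, rfl⟩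
  obtain ⟨θ, hθe, hθ⟩ := exists_chain_lift_of_projective (F := fun n => Fin (k n) → R) e D hed hD
    ε d hsurj hex0 hex
  obtain ⟨i, hi, φ, hφ, hφt, hφg⟩ := exists_tower_lift (F := fun n => Fin (k n) → R) J e D he hed
    hD (fun x hx => hk0.le hx) (fun n x hx => (hk n).le hx) (uniformlyStable_pi k) P dP
    (fun n m => LinearMap.congr_fun (hdP n m)) t ht htors hproj g
    (fun m => LinearMap.congr_fun (hgd m)) hgt
  refine ⟨i, hi, fun n m => (mapQPow J m (θ n)).comp (φ n m), fun n m => ?_, fun n m => ?_,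
    fun m => ?_⟩
  · ext x
    rw [LinearMap.comp_apply, LinearMap.comp_apply, mapQPow_mapQPow, hθ, ← mapQPow_mapQPow, hφ]
    rfl
  · ext x
    rw [LinearMap.comp_apply, LinearMap.comp_apply, transQPow_eq_factorPow, ← mapQPow_factorPow,
      ← transQPow_eq_factorPow, hφt]
    rfl
  · ext x
    rw [LinearMap.comp_apply, LinearMap.comp_apply, mapQPow_mapQPow, hθe, hφg, towerMap_transQPow]
    rfl
end

section
/- Let F be a field and S a smooth commutative F-algebra (formally smooth and of finite presentation over F). Let μ: S ⊗_F S → S be the multiplication map and J = ker(μ), so that J/J² ≅ Ω_{S/F} is a finitely generated projective S-module. Then there exist finitely many elements α_1, …, α_n ∈ S ⊗_F S such that the images μ(α_1), …, μ(α_n) generate the unit ideal of S, and for each i the ideal generated by J in the localization (S ⊗_F S)[1/α_i] (localization at the powers of α_i) is generated by a regular sequence; that is, J is locally a complete intersection on a neighborhood of the diagonal. -/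
open TensorProduct

universe u

namespace MvPolynomial

lemma isWeaklyRegular_ofFn_X (R : Type*) [CommRing R] (d : ℕ) :
    RingTheory.Sequence.IsWeaklyRegular (MvPolynomial (Fin d) R)
      (List.ofFn (X : Fin d → MvPolynomial (Fin d) R)) := by
  refine ⟨fun i hi ↦ ?_⟩
  have hid : i < d := by simpa using hi
  have hspan : Ideal.ofList ((List.ofFn (X : Fin d → MvPolynomial (Fin d) R)).take i) =
      Ideal.span (X '' {j : Fin d | (j : ℕ) < i}) := by
    rw [Ideal.ofList]
    congr 1
    ext x
    simp only [List.mem_take_iff_getElem, List.getElem_ofFn, Set.mem_ofPred_eq, Set.mem_image]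
    constructor
    · rintro ⟨j, hj, rfl⟩
      exact ⟨⟨j, by omega⟩, by simp; omega, rfl⟩
    · rintro ⟨j, hj, rfl⟩
      exact ⟨j, by simp; omega, rfl⟩
  rw [hspan, isSMulRegular_quotient_iff_mem_of_smul_mem]
  simp only [List.getElem_ofFn, smul_eq_mul, Ideal.mul_top]
  intro f hf
  rw [mem_ideal_span_X_image] at hf ⊢
  intro m hm
  obtain ⟨j, hj, hne⟩ := hf (Finsupp.single ⟨i, hid⟩ 1 + m) (by
    rw [mem_support_iff, coeff_X_mul]
    exact mem_support_iff.mp hm)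
  refine ⟨j, hj, ?_⟩
  have hji : (⟨i, hid⟩ : Fin d) ≠ j := by
    rintro rfl
    exact lt_irrefl i hj
  simpa [Finsupp.single_apply, hji] using hne

end MvPolynomial

/-- If `T'` is a localization of `T` away from `t` and `a : T` is a numerator of `α : T'`, then
any localization of `T` away from `t * a` receives a flat map from `T'` which inverts `α`. -/
lemma IsLocalization.Away.exists_flat_hom {T T' : Type*} [CommRing T] [CommRing T']
    [Algebra T T'] (t : T) [IsLocalization.Away t T'] {α : T'} {a : T} {n : ℕ}
    (ha : α * algebraMap T T' t ^ n = algebraMap T T' a) (L : Type*) [CommRing L] [Algebra T L]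
    [IsLocalization.Away (t * a) L] :
    ∃ ψ : T' →+* L, ψ.Flat ∧ IsUnit (ψ α) ∧ ψ.comp (algebraMap T T') = algebraMap T L := by
  let L₀ := Localization.Away α
  have hass : Associated (algebraMap T T' a) α := by
    rw [← ha]
    exact associated_mul_unit_left _ _ ((IsLocalization.Away.algebraMap_isUnit t).pow n)
  have : IsLocalization.Away (t * a) L₀ := .mul_of_associated t a α hass
  let e : L₀ ≃ₐ[T] L := IsLocalization.algEquiv (.powers (t * a)) L₀ L
  refine ⟨(e : L₀ →+* L).comp (algebraMap T' L₀), ?_, ?_, ?_⟩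
  · refine RingHom.Flat.comp ?_ (.of_bijective e.bijective)
    rw [RingHom.flat_algebraMap_iff]
    exact IsLocalization.flat L₀ (.powers α)
  · exact (IsLocalization.Away.algebraMap_isUnit α).map e
  · rw [RingHom.comp_assoc, ← IsScalarTower.algebraMap_eq]
    exact e.toAlgHom.comp_algebraMap

namespace Algebra.TensorProduct

variable {R A : Type*} [CommRing R] [CommRing A] [Algebra R A]

/-- If `A` is flat over `R[x₁, …, x_d]`, then `A[X₁, …, X_d] → A ⊗[R] A` sending `Xᵢ` to
`1 ⊗ xᵢ - xᵢ ⊗ 1` is flat. -/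
lemma flat_aeval_diff {d : ℕ} [Algebra (MvPolynomial (Fin d) R) A]
    [IsScalarTower R (MvPolynomial (Fin d) R) A] [Module.Flat (MvPolynomial (Fin d) R) A] :
    (MvPolynomial.aeval (R := A) fun i : Fin d ↦
      (1 ⊗ₜ algebraMap (MvPolynomial (Fin d) R) A (.X i) -
        algebraMap (MvPolynomial (Fin d) R) A (.X i) ⊗ₜ 1 : A ⊗[R] A)).toRingHom.Flat := by
  let x (i : Fin d) : A := algebraMap (MvPolynomial (Fin d) R) A (.X i)
  let s₁ : MvPolynomial (Fin d) A →ₐ[A] MvPolynomial (Fin d) A :=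
    MvPolynomial.aeval fun i ↦ .X i - .C (x i)
  let s₂ : MvPolynomial (Fin d) A →ₐ[A] MvPolynomial (Fin d) A :=
    MvPolynomial.aeval fun i ↦ .X i + .C (x i)
  let s : MvPolynomial (Fin d) A ≃ₐ[A] MvPolynomial (Fin d) A :=
    .ofAlgHom s₁ s₂ (by ext; simp [s₁, s₂]) (by ext; simp [s₁, s₂])
  let e : MvPolynomial (Fin d) A ≃ₐ[A] A ⊗[R] MvPolynomial (Fin d) R :=
    (MvPolynomial.algebraTensorAlgEquiv R A).symm
  let f : A ⊗[R] MvPolynomial (Fin d) R →ₐ[A] A ⊗[R] A :=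
    Algebra.TensorProduct.lTensor A (IsScalarTower.toAlgHom R (MvPolynomial (Fin d) R) A)
  have hf : f.toRingHom.Flat := by
    refine RingHom.Flat.lTensor (S := A) A ?_
    exact (RingHom.flat_algebraMap_iff (R := MvPolynomial (Fin d) R) (S := A)).mpr inferInstance
  have heq : (MvPolynomial.aeval (R := A) fun i : Fin d ↦
      (1 ⊗ₜ x i - x i ⊗ₜ 1 : A ⊗[R] A)) = f.comp (e.toAlgHom.comp s.toAlgHom) := by
    ext i
    have : e (MvPolynomial.C (x i)) = x i ⊗ₜ 1 := e.commutes (x i)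
    simp [s, s₁, e, f, x, MvPolynomial.algebraTensorAlgEquiv_symm_X] at this ⊢
    simp [this]
  change RingHom.Flat (MvPolynomial.aeval (R := A) fun i : Fin d ↦
      (1 ⊗ₜ x i - x i ⊗ₜ 1 : A ⊗[R] A)).toRingHom
  rw [heq]
  exact RingHom.Flat.comp (RingHom.Flat.of_bijective (e.bijective.comp s.bijective)) hf

/-- If `A` is étale over `R[x₁, …, x_d]`, then there is a weakly regular sequence contained in the
diagonal ideal of `A ⊗[R] A` which generates it after inverting some `α` that is `1` on the
diagonal. -/
theorem exists_isWeaklyRegular_of_etale (d : ℕ) [Algebra (MvPolynomial (Fin d) R) A]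
    [IsScalarTower R (MvPolynomial (Fin d) R) A] [Algebra.Etale (MvPolynomial (Fin d) R) A] :
    ∃ (xs : List (A ⊗[R] A)) (α : A ⊗[R] A),
      RingTheory.Sequence.IsWeaklyRegular (A ⊗[R] A) xs ∧ lmul' R α = 1 ∧
      Ideal.ofList xs ≤ RingHom.ker (lmul' R (S := A)) ∧
      ∀ y ∈ RingHom.ker (lmul' R (S := A)), α * y ∈ Ideal.ofList xs := by
  let P := MvPolynomial (Fin d) R
  let φ : MvPolynomial (Fin d) A →ₐ[A] A ⊗[R] A :=
    MvPolynomial.aeval fun i ↦ 1 ⊗ₜ algebraMap P A (.X i) - algebraMap P A (.X i) ⊗ₜ 1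
  let xs : List (A ⊗[R] A) := (List.ofFn MvPolynomial.X).map φ
  have hxs : Ideal.ofList xs = Ideal.span (Set.range fun i ↦
      (1 ⊗ₜ algebraMap P A (.X i) - algebraMap P A (.X i) ⊗ₜ 1 : A ⊗[R] A)) := by
    rw [Ideal.ofList]
    congr 1
    ext z
    simp [xs, φ, List.mem_ofFn]
  have hreg : RingTheory.Sequence.IsWeaklyRegular (A ⊗[R] A) xs := by
    have hφ : φ.toRingHom.Flat := flat_aeval_diff
    algebraize [φ.toRingHom]
    exact (MvPolynomial.isWeaklyRegular_ofFn_X A d).of_flat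
  have hle : Ideal.ofList xs ≤ RingHom.ker (lmul' R (S := A)) := by
    rw [hxs, Ideal.span_le]
    rintro _ ⟨i, rfl⟩
    simp [RingHom.mem_ker]
  let Q := (A ⊗[R] A) ⧸ Ideal.ofList xs
  let π : A ⊗[R] A →ₐ[R] Q := Ideal.Quotient.mkₐ R (Ideal.ofList xs)
  let ι₁ : A →ₐ[R] Q := π.comp includeLeft
  let ι₂ : A →ₐ[R] Q := π.comp includeRight
  have hι : ι₂.comp (IsScalarTower.toAlgHom R P A) = ι₁.comp (IsScalarTower.toAlgHom R P A) := by
    ext i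
    refine Ideal.Quotient.eq.mpr ?_
    rw [hxs]
    exact Ideal.subset_span ⟨i, rfl⟩
  let _ : Algebra P Q := (ι₁.comp (IsScalarTower.toAlgHom R P A)).toRingHom.toAlgebra
  let f₁ : A →ₐ[P] Q := { ι₁ with commutes' := fun _ ↦ rfl }
  let f₂ : A →ₐ[P] Q := { ι₂ with commutes' := fun p ↦ DFunLike.congr_fun hι p }
  let F : A ⊗[P] A →ₐ[P] Q := productMap f₁ f₂
  let m : Q →ₐ[R] A := Ideal.Quotient.liftₐ _ (lmul' R) hle
  have hm (t : A ⊗[P] A) : m (F t) = lmul' P t := by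
    induction t with
    | zero => simp
    | add x y hx hy => simp [hx, hy]
    | tmul a b =>
      change m (π (a ⊗ₜ 1) * π (1 ⊗ₜ b)) = a * b
      rw [← map_mul]
      change lmul' R (a ⊗ₜ 1 * 1 ⊗ₜ b) = a * b
      simp
  obtain ⟨t, ht, ht₁⟩ :=
    (Algebra.FormallyUnramified.iff_exists_tensorProduct (R := P) (S := A)).mp inferInstance
  obtain ⟨α, hα⟩ := Ideal.Quotient.mk_surjective (F t)
  refine ⟨xs, α, hreg, ?_, hle, fun y hy ↦ ?_⟩
  · rw [← ht₁, ← hm, ← hα]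
    rfl
  · change y ∈ KaehlerDifferential.ideal R A at hy
    rw [← KaehlerDifferential.span_range_eq_ideal] at hy
    induction hy using Submodule.span_induction with
    | zero => simp
    | add x y _ _ hx hy => rw [mul_add]; exact add_mem hx hy
    | smul c x _ hx => rw [smul_eq_mul, mul_left_comm]; exact Ideal.mul_mem_left _ _ hx
    | mem x hx =>
      obtain ⟨s, rfl⟩ := hx
      rw [← Ideal.Quotient.eq_zero_iff_mem, map_mul, hα, mul_comm]
      have := congrArg F (ht s)
      rw [map_mul, map_zero] at this
      rw [← this]
      congr 1
      simp only [map_sub, F, productMap_apply_tmul, map_one, one_mul, mul_one]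
      rfl

lemma isLocalizationAway_map (S : Type*) [CommRing S] [Algebra R S] [Algebra S A]
    [IsScalarTower R S A] (g : S) [IsLocalization.Away g A] :
    letI := (map (IsScalarTower.toAlgHom R S A) (IsScalarTower.toAlgHom R S A)).toRingHom.toAlgebra
    IsLocalization.Away (g ⊗ₜ g : S ⊗[R] S) (A ⊗[R] A) := by
  let ψ := IsScalarTower.toAlgHom R S A
  let φ₁ : S ⊗[R] S →ₐ[S] A ⊗[R] S := map (Algebra.ofId S A) (.id R S)
  let φ₂ : A ⊗[R] S →ₐ[A] A ⊗[R] A := map (.id A A) ψ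
  let φ : S ⊗[R] S →ₐ[R] A ⊗[R] A := map ψ ψ
  algebraize [φ₁.toRingHom, φ₂.toRingHom, φ.toRingHom]
  have : IsScalarTower (S ⊗[R] S) (A ⊗[R] S) (A ⊗[R] A) := .of_algebraMap_eq fun x ↦ by
    change φ x = φ₂ (φ₁ x)
    induction x with
    | zero => simp
    | add x y hx hy => simp [hx, hy]
    | tmul a b => simp [φ, φ₁, φ₂, ψ, Algebra.ofId_apply]
  have h₁ : IsLocalization.Away (g ⊗ₜ 1 : S ⊗[R] S) (A ⊗[R] S) := by
    have : .powers (g ⊗ₜ[R] 1) = Algebra.algebraMapSubmonoid (S ⊗[R] S) (.powers g) := by simp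
    rw [IsLocalization.Away, this]
    refine IsLocalization.tensorProduct_tensorProduct _ _ _ _ ?_
    ext; simp [RingHom.algebraMap_toAlgebra, φ₁]
  have h₂ : IsLocalization.Away (1 ⊗ₜ g : A ⊗[R] S) (A ⊗[R] A) := by
    have := IsLocalization.tensorProduct_tensorProduct_right R A (.powers g) A
      (by ext; simp [RingHom.algebraMap_toAlgebra, φ₂, ψ])
    simpa [IsLocalization.Away] using this
  have h₃ : IsLocalization.Away (algebraMap (S ⊗[R] S) (A ⊗[R] S) (1 ⊗ₜ g)) (A ⊗[R] A) := by
    convert h₂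
    simp [RingHom.algebraMap_toAlgebra, φ₁]
  have := IsLocalization.Away.mul' (A ⊗[R] S) (A ⊗[R] A) (g ⊗ₜ 1 : S ⊗[R] S) (1 ⊗ₜ g)
  simpa using this

lemma lmul'_map_toAlgHom {S : Type*} [CommRing S] [Algebra R S] [Algebra S A]
    [IsScalarTower R S A] (z : S ⊗[R] S) :
    lmul' R (map (IsScalarTower.toAlgHom R S A) (IsScalarTower.toAlgHom R S A) z) =
      algebraMap S A (lmul' R z) := by
  induction z with
  | zero => simp
  | add x y hx hy => simp [hx, hy]
  | tmul a b => simp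

/-- The formation of the diagonal ideal commutes with localization. -/
lemma map_ker_lmul' {S : Type*} [CommRing S] [Algebra R S] [Algebra S A]
    [IsScalarTower R S A] (g : S) [IsLocalization.Away g A] :
    (RingHom.ker (lmul' R (S := S))).map
      (map (IsScalarTower.toAlgHom R S A) (IsScalarTower.toAlgHom R S A)) =
    RingHom.ker (lmul' R (S := A)) := by
  let φ := map (IsScalarTower.toAlgHom R S A) (IsScalarTower.toAlgHom R S A)
  have hφ (z : S ⊗[R] S) : lmul' R (φ z) = algebraMap S A (lmul' R z) := lmul'_map_toAlgHom z
  have hloc := isLocalizationAway_map (R := R) (A := A) S g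
  algebraize [φ.toRingHom]
  change (RingHom.ker (lmul' R (S := S))).map (algebraMap (S ⊗[R] S) (A ⊗[R] A)) = _
  change ∀ z, lmul' R (algebraMap (S ⊗[R] S) (A ⊗[R] A) z) = _ at hφ
  apply le_antisymm
  · rw [Ideal.map_le_iff_le_comap]
    intro z hz
    rw [RingHom.mem_ker] at hz
    rw [Ideal.mem_comap, RingHom.mem_ker, hφ, hz, map_zero]
  · intro y hy
    rw [RingHom.mem_ker] at hy
    obtain ⟨n, a, ha⟩ := IsLocalization.Away.surj (g ⊗ₜ g : S ⊗[R] S) y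
    have h0 : algebraMap S A (lmul' R a) = algebraMap S A 0 := by
      rw [← hφ, ← ha, map_mul, hy, zero_mul, map_zero]
    obtain ⟨m, hm⟩ := IsLocalization.Away.exists_of_eq g h0
    have hu : IsUnit (algebraMap (S ⊗[R] S) (A ⊗[R] A) ((g ⊗ₜ g) ^ m * (g ⊗ₜ g) ^ n)) := by
      rw [← pow_add, map_pow]
      exact (IsLocalization.Away.algebraMap_isUnit _).pow _
    rw [← Ideal.unit_mul_mem_iff_mem _ hu, map_mul, map_pow _ _ n, mul_assoc, mul_comm (_ ^ n), ha,
      ← map_mul]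
    refine Ideal.mem_map_of_mem _ ?_
    rw [RingHom.mem_ker, map_mul, map_pow, lmul'_apply_tmul, mul_pow, mul_assoc, hm, mul_zero,
      mul_zero]

/-- If `S` is smooth over `R`, then near every point of the diagonal the diagonal ideal is
generated by a regular sequence. -/
theorem exists_isRegular_of_notMem {S : Type*} [CommRing S] [Algebra R S]
    [Algebra.Smooth R S] (p : Ideal S) [p.IsPrime] :
    ∃ β : S ⊗[R] S, lmul' R β ∉ p ∧ ∃ xs : List (Localization.Away β),
      RingTheory.Sequence.IsRegular (Localization.Away β) xs ∧
      (RingHom.ker (lmul' R (S := S))).map (algebraMap (S ⊗[R] S) (Localization.Away β)) =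
        Ideal.ofList xs := by
  have : IsSmoothAt R p := by
    have : (⟨p, inferInstance⟩ : PrimeSpectrum S) ∈ smoothLocus R S := by
      simp [smoothLocus_eq_univ]
    exact this
  obtain ⟨g, hg, d, _, _, _⟩ := IsSmoothAt.exists_isStandardEtale_mvPolynomial (R := R) (p := p)
  let A := Localization.Away g
  obtain ⟨xs, α, hxs, hα, hle, hmul⟩ := exists_isWeaklyRegular_of_etale (R := R) (A := A) d
  let φ := map (IsScalarTower.toAlgHom R S A) (IsScalarTower.toAlgHom R S A)
  have hφ (z : S ⊗[R] S) : lmul' R (φ z) = algebraMap S A (lmul' R z) := lmul'_map_toAlgHom z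
  have hker : _ = RingHom.ker (lmul' R (S := A)) := map_ker_lmul' g
  have hloc := isLocalizationAway_map (R := R) (A := A) S g
  let _ : Algebra (S ⊗[R] S) (A ⊗[R] A) := φ.toRingHom.toAlgebra
  obtain ⟨n, a, ha⟩ := IsLocalization.Away.surj (g ⊗ₜ g : S ⊗[R] S) α
  let β : S ⊗[R] S := g ⊗ₜ g * a
  have hβ : lmul' R β ∉ p := by
    have h₁ : algebraMap S A (lmul' R a) = algebraMap S A ((g * g) ^ n) := by
      rw [← hφ, ← lmul'_apply_tmul (R := R), ← map_pow, ← hφ, map_pow]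
      change lmul' R (algebraMap (S ⊗[R] S) (A ⊗[R] A) a) = _
      rw [← ha, map_mul, hα, one_mul]
      rfl
    obtain ⟨m, hm⟩ := IsLocalization.Away.exists_of_eq g h₁
    have hgp (k : ℕ) : g ^ k ∉ p := fun h ↦ hg (Ideal.IsPrime.mem_of_pow_mem ‹_› k h)
    have hgg : g * g ∉ p := by simpa [pow_two] using hgp 2
    have : lmul' R a ∉ p := by
      intro h
      have := p.mul_mem_left (g ^ m) h
      rw [hm] at this
      exact (Ideal.IsPrime.mem_or_mem ‹_› this).elim (hgp m)
        fun h ↦ hgg (Ideal.IsPrime.mem_of_pow_mem ‹_› n h)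
    rw [map_mul, lmul'_apply_tmul]
    exact fun h ↦ (Ideal.IsPrime.mem_or_mem ‹_› h).elim hgg this
  let L := Localization.Away β
  obtain ⟨ψ, hψ, hψα, hψT⟩ := IsLocalization.Away.exists_flat_hom (g ⊗ₜ g : S ⊗[R] S) ha L
  have hmap : (RingHom.ker (lmul' R (S := S))).map (algebraMap (S ⊗[R] S) L) =
      Ideal.ofList (xs.map ψ) := by
    rw [← Ideal.map_ofList, ← hψT, ← Ideal.map_map]
    change Ideal.map ψ (Ideal.map φ _) = _
    rw [hker]
    refine le_antisymm (Ideal.map_le_iff_le_comap.mpr fun y hy ↦ ?_) (Ideal.map_mono hle)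
    rw [Ideal.mem_comap, ← Ideal.unit_mul_mem_iff_mem _ hψα, ← map_mul]
    exact Ideal.mem_map_of_mem ψ (hmul y hy)
  refine ⟨β, hβ, xs.map ψ, ⟨?_, ?_⟩, hmap⟩
  · algebraize [ψ]
    exact hxs.of_flat
  · rw [← hmap, smul_eq_mul, Ideal.mul_top, ne_comm,
      IsLocalization.map_algebraMap_ne_top_iff_disjoint (.powers β), Set.disjoint_left]
    rintro _ ⟨k, rfl⟩ hk
    have hk : lmul' R (β ^ k) = 0 := hk
    refine hβ (Ideal.IsPrime.mem_of_pow_mem ‹_› k ?_)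
    rw [← map_pow, hk]
    exact p.zero_mem

end Algebra.TensorProduct

/-- **The diagonal ideal of a smooth algebra is locally a complete intersection.**
Let `F` be a field and `S` a smooth (formally smooth and finitely presented) commutative
`F`-algebra.  Let `μ : S ⊗[F] S → S` be the multiplication map and `J = ker μ`.  Then
there are finitely many elements `α 1, …, α n ∈ S ⊗[F] S` whose images
`μ (α 1), …, μ (α n)` generate the unit ideal of `S`, and such that for each `i` the
ideal generated by `J` in the localization `(S ⊗[F] S)[1/α i]` is generated by a
regular sequence. -/
theorem diagonal_ideal_locally_complete_intersection
    (F S : Type u) [Field F] [CommRing S] [Algebra F S]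
    [Algebra.FormallySmooth F S] [Algebra.FinitePresentation F S] :
    ∃ (n : ℕ) (α : Fin n → S ⊗[F] S),
      Ideal.span (Set.range fun i => Algebra.TensorProduct.lmul' F (S := S) (α i)) = ⊤ ∧
      ∀ i : Fin n,
        ∃ xs : List (Localization.Away (α i)),
          RingTheory.Sequence.IsRegular (Localization.Away (α i)) xs ∧
          Ideal.map (algebraMap (S ⊗[F] S) (Localization.Away (α i)))
              (RingHom.ker (Algebra.TensorProduct.lmul' F (S := S)))
            = Ideal.ofList xs := by
  have : Algebra.Smooth F S := ⟨inferInstance, inferInstance⟩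
  choose β hβ hreg using fun p : PrimeSpectrum S ↦
    Algebra.TensorProduct.exists_isRegular_of_notMem (R := F) p.asIdeal
  have hspan : Ideal.span (Set.range fun p ↦ Algebra.TensorProduct.lmul' F (β p)) = ⊤ := by
    by_contra h
    obtain ⟨m, hm, hle⟩ := Ideal.exists_le_maximal _ h
    exact hβ ⟨m, hm.isPrime⟩ (hle (Ideal.subset_span ⟨_, rfl⟩))
  obtain ⟨s, hs, hs'⟩ := (Ideal.span_eq_top_iff_finite _).mp hspan
  choose q hq using fun i : s ↦ hs i.2
  refine ⟨s.card, fun i ↦ β (q (s.equivFin.symm i)), ?_, fun i ↦ hreg _⟩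
  convert hs'
  ext x
  simp only [hq, Set.mem_range, SetLike.mem_coe]
  exact ⟨fun ⟨i, hi⟩ ↦ hi ▸ Subtype.prop _, fun hx ↦ ⟨s.equivFin ⟨x, hx⟩, by simp⟩⟩
end
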